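/- arXiv:1403.0691 — 3 statements merged into one kernel-verified Lean document; each statement's English description precedes it below -/
import Mathlib

section
/- liminf_{n→∞} ( α_n(21-34) / n! )^{1/n} ≥ 1/(2·log 2); in particular, α_n(21-34) ≥ (1/(2·log 2) + o(1))^n · n!. -/
/-- `π ∈ S_n` contains the generalized pattern 21-34: there are 1-indexed positions
`1 ≤ i < i+1 < j < j+1 ≤ n` (here 0-indexed) with `π(i+1) < π(i) < π(j) < π(j+1)`. -/
def Contains2134 {n : ℕ} (π : Equiv.Perm (Fin n)) : Prop :=
  ∃ i j : ℕ, ∃ h1 : i + 1 < j, ∃ h2 : j + 1 < n,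
    π ⟨i + 1, by omega⟩ < π ⟨i, by omega⟩ ∧
    π ⟨i, by omega⟩ < π ⟨j, by omega⟩ ∧
    π ⟨j, by omega⟩ < π ⟨j + 1, h2⟩

/-- `α_n(21-34)`: the number of `π ∈ S_n` avoiding 21-34. -/
noncomputable def avoidCount2134 (n : ℕ) : ℕ :=
  Nat.card {π : Equiv.Perm (Fin n) // ¬ Contains2134 π}

/-- A level function on `{0, …, n - 1}`: the values below `m` get odd levels, those in `[m, 2m)` get
positive even levels, and the rest get level `0`; the odd level `r` is used iff `r + 1` is. -/
structure IsLevel (m : ℕ) {n : ℕ} (h : Fin n → ℕ) : Prop where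
  odd_of_lt : ∀ v : Fin n, (v : ℕ) < m → h v % 2 = 1
  even_of_le : ∀ v : Fin n, m ≤ (v : ℕ) → h v % 2 = 0
  eq_zero : ∀ v : Fin n, 2 * m ≤ (v : ℕ) → h v = 0
  exists_succ : ∀ v : Fin n, (v : ℕ) < m → ∃ u : Fin n, m ≤ (u : ℕ) ∧ h u = h v + 1
  exists_pred : ∀ u : Fin n, m ≤ (u : ℕ) → (u : ℕ) < 2 * m →
    ∃ v : Fin n, (v : ℕ) < m ∧ h u = h v + 1

/-- Sort by level, then increasingly among the values below `m` and decreasingly among the others. -/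
def levelKey (m : ℕ) {n : ℕ} (h : Fin n → ℕ) (v : Fin n) : ℕ ×ₗ ℤ :=
  toLex (h v, if (v : ℕ) < m then (v : ℤ) else -(v : ℤ))

lemma levelKey_lt_iff {m n : ℕ} {h : Fin n → ℕ} {u v : Fin n} :
    levelKey m h u < levelKey m h v ↔ h u < h v ∨ h u = h v ∧
      (if (u : ℕ) < m then (u : ℤ) else -(u : ℤ)) < if (v : ℕ) < m then (v : ℤ) else -(v : ℤ) := by
  simp [levelKey, Prod.Lex.toLex_lt_toLex]

lemma IsLevel.levelKey_injective {m n : ℕ} {h : Fin n → ℕ} (hh : IsLevel m h) :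
    Function.Injective (levelKey m h) := by
  intro u v huv
  have h1 : h u = h v := congrArg (fun x => (ofLex x).1) huv
  have h2 : (if (u : ℕ) < m then (u : ℤ) else -(u : ℤ)) =
      if (v : ℕ) < m then (v : ℤ) else -(v : ℤ) := congrArg (fun x => (ofLex x).2) huv
  have hu := hh.odd_of_lt u
  have hv := hh.odd_of_lt v
  have hu' := hh.even_of_le u
  have hv' := hh.even_of_le v
  ext
  split_ifs at h2 <;> omega

/-- The permutation listing the values in the order of their keys. -/
def levelPerm (m : ℕ) {n : ℕ} (h : Fin n → ℕ) : Equiv.Perm (Fin n) :=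
  Tuple.sort (levelKey m h)

lemma IsLevel.strictMono {m n : ℕ} {h : Fin n → ℕ} (hh : IsLevel m h) :
    StrictMono (levelKey m h ∘ levelPerm m h) :=
  (Tuple.monotone_sort (levelKey m h)).strictMono_of_injective
    (hh.levelKey_injective.comp (Equiv.injective _))

lemma IsLevel.not_between {m n : ℕ} {h : Fin n → ℕ} (hh : IsLevel m h) {i : ℕ} (hi : i + 1 < n)
    (v : Fin n) (h1 : h (levelPerm m h ⟨i, by omega⟩) < h v)
    (h2 : h v < h (levelPerm m h ⟨i + 1, hi⟩)) : False := by
  obtain ⟨p, rfl⟩ := (levelPerm m h).surjective v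
  have a1 := hh.strictMono.lt_iff_lt.1 (show (levelKey m h ∘ levelPerm m h) _ <
    (levelKey m h ∘ levelPerm m h) p from levelKey_lt_iff.2 (Or.inl h1))
  have a2 := hh.strictMono.lt_iff_lt.1 (show (levelKey m h ∘ levelPerm m h) p <
    (levelKey m h ∘ levelPerm m h) _ from levelKey_lt_iff.2 (Or.inl h2))
  simp only [Fin.lt_def] at a1 a2
  omega

lemma IsLevel.not_contains {m n : ℕ} {h : Fin n → ℕ} (hh : IsLevel m h) :
    ¬ Contains2134 (levelPerm m h) := by
  rintro ⟨i, j, h1, h2, hd, hm, ha⟩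
  have key : ∀ i (hi : i + 1 < n), _ := fun i hi => levelKey_lt_iff.1
    (hh.strictMono (show (⟨i, by omega⟩ : Fin n) < ⟨i + 1, hi⟩ by simp [Fin.lt_def]))
  have ki := key i (by omega)
  have kj := key j h2
  have bi := fun v => hh.not_between (i := i) (by omega) v
  have bj := fun v => hh.not_between h2 v
  generalize levelPerm m h ⟨i, _⟩ = a at *
  generalize levelPerm m h ⟨i + 1, _⟩ = b at *
  generalize levelPerm m h ⟨j, _⟩ = c at *
  generalize levelPerm m h ⟨j + 1, _⟩ = d at *
  simp only [Fin.lt_def] at hd hm ha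
  have ham : m ≤ (a : ℕ) := by
    by_contra! ham
    obtain ⟨u, hu, hua⟩ := hh.exists_succ a ham
    rw [if_pos ham, if_pos (by omega)] at ki
    have := hh.odd_of_lt a ham
    have := hh.odd_of_lt b (by omega)
    exact bi u (by omega) (by omega)
  rw [if_neg (by omega), if_neg (by omega)] at kj
  by_cases hd2 : (d : ℕ) < 2 * m
  · obtain ⟨v, hv, hdv⟩ := hh.exists_pred d (by omega) hd2
    have := hh.even_of_le c (by omega)
    have := hh.odd_of_lt v hv
    exact bj v (by omega) (by omega)
  · have := hh.eq_zero d (by omega)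
    have := hh.eq_zero c
    have := hh.even_of_le c (by omega)
    omega

lemma IsLevel.eq_of_levelPerm_eq {m n : ℕ} {h h' : Fin n → ℕ} (hh : IsLevel m h)
    (hh' : IsLevel m h') (hr : Set.range h = Set.range h')
    (heq : levelPerm m h = levelPerm m h') : h = h' := by
  have hlt : ∀ u v, levelKey m h u < levelKey m h v ↔ levelKey m h' u < levelKey m h' v := by
    intro u v
    obtain ⟨p, rfl⟩ := (levelPerm m h).surjective u
    obtain ⟨q, rfl⟩ := (levelPerm m h).surjective v
    have e1 := hh.strictMono.lt_iff_lt (a := p) (b := q)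
    have e2 := hh'.strictMono.lt_iff_lt (a := p) (b := q)
    rw [← heq] at e2
    exact e1.trans e2.symm
  have lt_of : ∀ {h h' : Fin n → ℕ}, IsLevel m h → IsLevel m h' → Set.range h ⊆ Set.range h' →
      (∀ u v, levelKey m h u < levelKey m h v ↔ levelKey m h' u < levelKey m h' v) →
      ∀ p, (∀ v, levelKey m h v < levelKey m h p → h v = h' v) → ¬ h p < h' p := by
    intro h h' hh hh' hr hlt p hp hlp
    have contra : ∀ v, h p < h' v → h' v < h' p → False := by
      intro v h1 h2
      have a := (hlt v p).2 (levelKey_lt_iff.2 (Or.inl h2))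
      have b := hp v a
      rcases levelKey_lt_iff.1 a with c | c <;> omega
    by_cases hpm : (p : ℕ) < m
    · have o := hh.odd_of_lt p hpm
      have o' := hh'.odd_of_lt p hpm
      obtain ⟨u, hu, hup⟩ := hh.exists_succ p hpm
      obtain ⟨w, hw⟩ := hr ⟨u, rfl⟩
      exact contra w (by omega) (by omega)
    · have o := hh.even_of_le p (by omega)
      have o' := hh'.even_of_le p (by omega)
      by_cases hp2 : (p : ℕ) < 2 * m
      · obtain ⟨v, hv, hvp⟩ := hh'.exists_pred p (by omega) hp2
        exact contra v (by omega) (by omega)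
      · have := hh'.eq_zero p (by omega)
        omega
  by_contra hne
  obtain ⟨v, hv⟩ := Function.ne_iff.1 hne
  have wf : WellFounded fun u v : Fin n => levelKey m h u < levelKey m h v :=
    @Finite.wellFounded_of_trans_of_irrefl _ _ _ ⟨fun _ _ _ => lt_trans⟩ ⟨fun _ => lt_irrefl _⟩
  have hmin : ∀ u, levelKey m h u < levelKey m h (wf.min {v | h v ≠ h' v} ⟨v, hv⟩) →
      h u = h' u := by
    intro u hu
    by_contra hne
    exact wf.not_lt_min {v | h v ≠ h' v} hne hu
  have hp := wf.min_mem {v | h v ≠ h' v} ⟨v, hv⟩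
  generalize wf.min {v | h v ≠ h' v} ⟨v, hv⟩ = p at *
  rcases lt_or_gt_of_ne hp with hp | hp
  · exact lt_of hh hh' hr.subset hlt p hmin hp
  · exact lt_of hh' hh hr.superset (fun u v => (hlt u v).symm) p
      (fun v hv => (hmin v ((hlt v p).2 hv)).symm) hp

/-- Two maps `Fin m → Fin k` give the levels of the values below `m` and of those in `[m, 2m)`. -/
def pairLevel {m k : ℕ} (f g : Fin m → Fin k) (n : ℕ) (v : Fin n) : ℕ :=
  if hv : (v : ℕ) < m then 2 * (f ⟨v, hv⟩ : ℕ) + 1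
  else if hv : (v : ℕ) - m < m then 2 * (g ⟨(v : ℕ) - m, hv⟩ : ℕ) + 2 else 0

section pairLevel

variable {m k n : ℕ} {f g : Fin m → Fin k}

lemma pairLevel_of_lt (v : Fin m) (hv : (v : ℕ) < n) :
    pairLevel f g n ⟨v, hv⟩ = 2 * (f v : ℕ) + 1 := by
  simp [pairLevel]

lemma pairLevel_of_add (v : Fin m) (hv : m + (v : ℕ) < n) :
    pairLevel f g n ⟨m + v, hv⟩ = 2 * (g v : ℕ) + 2 := by
  simp [pairLevel]

lemma exists_eq_or_two_mul_le (hn : 2 * m ≤ n) (v : Fin n) :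
    (∃ w : Fin m, v = ⟨w, by omega⟩) ∨ (∃ w : Fin m, v = ⟨m + w, by omega⟩) ∨
      2 * m ≤ (v : ℕ) := by
  by_cases h1 : (v : ℕ) < m
  · exact Or.inl ⟨⟨v, h1⟩, rfl⟩
  by_cases h2 : (v : ℕ) < 2 * m
  · exact Or.inr (Or.inl ⟨⟨v - m, by omega⟩, Fin.ext (by simp; omega)⟩)
  · exact Or.inr (Or.inr (by omega))

lemma pairLevel_of_le {v : Fin n} (hv : 2 * m ≤ (v : ℕ)) : pairLevel f g n v = 0 := by
  rw [pairLevel, dif_neg (by omega), dif_neg (by omega)]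

lemma isLevel_pairLevel (hn : 2 * m ≤ n) (hfg : Set.range f = Set.range g) :
    IsLevel m (pairLevel f g n) where
  odd_of_lt v hv := by
    rw [pairLevel, dif_pos hv]
    omega
  even_of_le v hv := by
    rw [pairLevel, dif_neg (by omega)]
    split_ifs <;> omega
  eq_zero v hv := pairLevel_of_le hv
  exists_succ v hv := by
    obtain ⟨w, hw⟩ := hfg.subset ⟨⟨v, hv⟩, rfl⟩
    refine ⟨⟨m + w, by omega⟩, by simp, ?_⟩
    rw [pairLevel_of_add, hw, pairLevel, dif_pos hv]
  exists_pred u hu hu2 := by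
    obtain ⟨w, hw⟩ := hfg.superset ⟨⟨u - m, by omega⟩, rfl⟩
    refine ⟨⟨w, by omega⟩, by simp, ?_⟩
    rw [pairLevel_of_lt, hw, pairLevel, dif_neg (by omega), dif_pos (by omega)]

lemma range_pairLevel_subset {f' g' : Fin m → Fin k} (hn : 2 * m ≤ n)
    (hf : Set.range f = Set.range f') (hg : Set.range g = Set.range g') :
    Set.range (pairLevel f g n) ⊆ Set.range (pairLevel f' g' n) := by
  rintro _ ⟨v, rfl⟩
  rcases exists_eq_or_two_mul_le hn v with ⟨w, rfl⟩ | ⟨w, rfl⟩ | hv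
  · obtain ⟨x, hx⟩ := hf.subset ⟨w, rfl⟩
    exact ⟨⟨x, by omega⟩, by rw [pairLevel_of_lt, pairLevel_of_lt, hx]⟩
  · obtain ⟨x, hx⟩ := hg.subset ⟨w, rfl⟩
    exact ⟨⟨m + x, by omega⟩, by rw [pairLevel_of_add, pairLevel_of_add, hx]⟩
  · exact ⟨v, by rw [pairLevel_of_le hv, pairLevel_of_le hv]⟩

lemma pairLevel_inj {f' g' : Fin m → Fin k} (hn : 2 * m ≤ n)
    (h : pairLevel f g n = pairLevel f' g' n) : f = f' ∧ g = g' := by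
  refine ⟨funext fun v => Fin.ext ?_, funext fun v => Fin.ext ?_⟩
  · have := congrFun h ⟨v, by omega⟩
    rw [pairLevel_of_lt, pairLevel_of_lt] at this
    omega
  · have := congrFun h ⟨m + v, by omega⟩
    rw [pairLevel_of_add, pairLevel_of_add] at this
    omega

end pairLevel

lemma sq_card_range_eq_le_avoidCount2134 {m n : ℕ} (hn : 2 * m ≤ n) {k : ℕ}
    (R : Set (Fin k)) : Nat.card {f : Fin m → Fin k // Set.range f = R} ^ 2 ≤ avoidCount2134 n := by
  rw [sq, ← Nat.card_prod, avoidCount2134]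
  have hl (x : {f : Fin m → Fin k // Set.range f = R} × {f : Fin m → Fin k // Set.range f = R}) :
      IsLevel m (pairLevel x.1.1 x.2.1 n) :=
    isLevel_pairLevel hn (x.1.2.trans x.2.2.symm)
  refine Nat.card_le_card_of_injective
    (fun x => ⟨levelPerm m (pairLevel x.1.1 x.2.1 n), (hl x).not_contains⟩) ?_
  intro x y hxy
  have h := pairLevel_inj hn <| (hl x).eq_of_levelPerm_eq (hl y)
    ((range_pairLevel_subset hn (x.1.2.trans y.1.2.symm) (x.2.2.trans y.2.2.symm)).antisymm
      (range_pairLevel_subset hn (y.1.2.trans x.1.2.symm) (y.2.2.trans x.2.2.symm)))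
    (congrArg Subtype.val hxy)
  exact Prod.ext (Subtype.ext h.1) (Subtype.ext h.2)

lemma exists_pow_le_two_pow_mul_card (m k : ℕ) :
    ∃ R : Set (Fin k), k ^ m ≤ 2 ^ k * Nat.card {f : Fin m → Fin k // Set.range f = R} := by
  classical
  by_contra! h
  have hsum : k ^ m = ∑ R : Set (Fin k), Nat.card {f : Fin m → Fin k // Set.range f = R} := by
    rw [← Nat.card_sigma, Nat.card_congr (Equiv.sigmaFiberEquiv (Set.range : (Fin m → Fin k) → _))]
    simp
  have := Finset.sum_lt_sum_of_nonempty Finset.univ_nonempty fun R _ => h R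
  rw [← Finset.mul_sum, ← hsum] at this
  simp at this

lemma sq_le_avoidCount2134 {m n : ℕ} (hn : 2 * m ≤ n) (k : ℕ) :
    ((k : ℝ) ^ m / 2 ^ k) ^ 2 ≤ avoidCount2134 n := by
  obtain ⟨R, hR⟩ := exists_pow_le_two_pow_mul_card m k
  have h : (k : ℝ) ^ m / 2 ^ k ≤ Nat.card {f : Fin m → Fin k // Set.range f = R} := by
    rw [div_le_iff₀' (by positivity)]
    exact_mod_cast hR
  calc _ ≤ (Nat.card {f : Fin m → Fin k // Set.range f = R} : ℝ) ^ 2 := by gcongr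
    _ ≤ _ := by exact_mod_cast sq_card_range_eq_le_avoidCount2134 hn R

lemma factorial_mul_exp_le {m : ℕ} (hm : 1 ≤ m) :
    (m.factorial : ℝ) * Real.exp m ≤ Real.exp 1 * (m : ℝ) ^ (m + 1) := by
  induction m, hm using Nat.le_induction with
  | base => simp
  | succ m hm ih =>
    have hm0 : (0 : ℝ) < m := by exact_mod_cast hm
    have h : Real.exp 1 * (m : ℝ) ^ (m + 1) ≤ ((m : ℝ) + 1) ^ (m + 1) := by
      have h1 : (m : ℝ) / (m + 1) ≤ Real.exp (-(1 / (m + 1))) := by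
        have := Real.add_one_le_exp (-(1 / ((m : ℝ) + 1)))
        convert this using 1
        field_simp
        ring
      have h2 : ((m : ℝ) / (m + 1)) ^ (m + 1) ≤ Real.exp (-1) := by
        refine (pow_le_pow_left₀ (by positivity) h1 _).trans_eq ?_
        rw [← Real.exp_nat_mul]
        congr 1
        push_cast
        field_simp
      rw [div_pow, div_le_iff₀ (by positivity), Real.exp_neg] at h2
      field_simp at h2
      linarith
    rw [Nat.factorial_succ]
    push_cast
    rw [Real.exp_add]
    calc _ = ((m : ℝ) + 1) * Real.exp 1 * (m.factorial * Real.exp m) := by ring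
      _ ≤ ((m : ℝ) + 1) * Real.exp 1 * (Real.exp 1 * (m : ℝ) ^ (m + 1)) := by gcongr
      _ ≤ ((m : ℝ) + 1) * Real.exp 1 * ((m : ℝ) + 1) ^ (m + 1) := by gcongr
      _ = _ := by ring

lemma div_pow_le_pow_div (m : ℕ) : (m / Real.log 2) ^ m / (2 * Real.exp m) ≤
    (⌈m / Real.log 2⌉₊ : ℝ) ^ m / 2 ^ ⌈m / Real.log 2⌉₊ := by
  have hL := Real.log_pos one_lt_two
  have hk := Nat.le_ceil ((m : ℝ) / Real.log 2)
  have hk' := (Nat.ceil_lt_add_one (a := (m : ℝ) / Real.log 2) (by positivity)).le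
  gcongr
  calc (2 : ℝ) ^ ⌈m / Real.log 2⌉₊ = (2 : ℝ) ^ (⌈m / Real.log 2⌉₊ : ℝ) := by simp
    _ ≤ (2 : ℝ) ^ ((m : ℝ) / Real.log 2 + 1) := by gcongr; norm_num
    _ = 2 * Real.exp m := by
      rw [Real.rpow_add (by norm_num), Real.rpow_one, Real.rpow_def_of_pos (by norm_num),
        mul_div_cancel₀ _ hL.ne', mul_comm]

lemma pow_div_le_avoidCount2134_div {n : ℕ} (hn : 2 ≤ n) :
    (1 / (2 * Real.log 2)) ^ n / (4 * Real.exp 1 * n ^ 2) ≤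
      avoidCount2134 n / (n.factorial : ℝ) := by
  have hL := Real.log_pos one_lt_two
  obtain ⟨m, hm, hm'⟩ : ∃ m, 2 * m ≤ n ∧ n ≤ 2 * m + 1 := ⟨n / 2, by omega, by omega⟩
  have hm0 : (0 : ℝ) < m := by exact_mod_cast (by omega : 0 < m)
  have hn0 : (0 : ℝ) < n := by exact_mod_cast (by omega : 0 < n)
  have hfac : (n.factorial : ℝ) ≤ n * (2 * m).factorial := by
    obtain rfl | rfl : n = 2 * m ∨ n = 2 * m + 1 := by omega
    · exact le_mul_of_one_le_left (by positivity) (by exact_mod_cast (by omega : 1 ≤ 2 * m))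
    · rw [Nat.factorial_succ, Nat.cast_mul]
  have hst := factorial_mul_exp_le (m := 2 * m) (by omega)
  have hav := (pow_le_pow_left₀ (by positivity) (div_pow_le_pow_div m) 2).trans
    (sq_le_avoidCount2134 hm _)
  have hc : (1 / (2 * Real.log 2)) ^ n ≤ (1 / (2 * Real.log 2)) ^ (2 * m) := by
    refine pow_le_pow_of_le_one (by positivity) ?_ hm
    rw [div_le_one (by positivity)]
    linarith [Real.log_two_gt_d9]
  have hmn : (2 : ℝ) * m ≤ n := by exact_mod_cast hm
  rw [le_div_iff₀ (by positivity)]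
  refine le_trans ?_ hav
  have hfac' : (n.factorial : ℝ) ≤
      n * (Real.exp 1 * (2 * m) ^ (2 * m + 1) / Real.exp (2 * m)) := by
    refine hfac.trans ?_
    gcongr
    rw [le_div_iff₀ (by positivity)]
    exact_mod_cast hst
  calc _ ≤ (1 / (2 * Real.log 2)) ^ (2 * m) / (4 * Real.exp 1 * n ^ 2) *
        (n * (Real.exp 1 * (2 * m) ^ (2 * m + 1) / Real.exp (2 * m))) := by gcongr
    _ = (1 / (2 * Real.log 2)) ^ (2 * m) * (2 * m) ^ (2 * m) / (4 * Real.exp (2 * m)) *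
        ((2 * m) / n) := by
      field_simp
      ring
    _ ≤ (1 / (2 * Real.log 2)) ^ (2 * m) * (2 * m) ^ (2 * m) / (4 * Real.exp (2 * m)) * 1 := by
      gcongr
      rwa [div_le_one hn0]
    _ = _ := by
      rw [← mul_pow, div_pow, ← pow_mul, mul_comm m 2, mul_pow 2 (Real.exp _), ← Real.exp_nat_mul]
      have : 1 / (2 * Real.log 2) * (2 * m) = m / Real.log 2 := by field_simp
      rw [this]
      norm_num

lemma tendsto_pow_div_rpow_inv {c C : ℝ} (hc : 0 < c) (hC : 0 < C) :
    Filter.Tendsto (fun n : ℕ => (c ^ n / (C * (n : ℝ) ^ 2)) ^ ((n : ℝ)⁻¹)) Filter.atTop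
      (nhds c) := by
  have h0 : Filter.Tendsto (fun n : ℕ => (n : ℝ) ^ ((n : ℝ)⁻¹)) Filter.atTop (nhds 1) := by
    simpa [Function.comp_def] using tendsto_rpow_div.comp tendsto_natCast_atTop_atTop
  have h1 : Filter.Tendsto (fun n : ℕ => C ^ ((n : ℝ)⁻¹)) Filter.atTop (nhds 1) := by
    have h := tendsto_inv_atTop_nhds_zero_nat (𝕜 := ℝ)
    simpa using tendsto_const_nhds.rpow h (Or.inl hC.ne')
  have h2 := (tendsto_const_nhds (x := c)).div (h1.mul (h0.pow 2)) (by norm_num)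
  rw [one_pow, mul_one, div_one] at h2
  refine h2.congr' ?_
  filter_upwards [Filter.eventually_gt_atTop 0] with n hn
  simp only [Pi.div_apply]
  rw [Real.div_rpow (by positivity) (by positivity), Real.mul_rpow (by positivity) (by positivity),
    Real.pow_rpow_inv_natCast hc.le hn.ne', Real.rpow_pow_comm (by positivity)]

lemma avoidCount2134_le_factorial (n : ℕ) : avoidCount2134 n ≤ n.factorial := by
  refine (Nat.card_le_card_of_injective _ Subtype.val_injective).trans_eq ?_
  rw [Nat.card_perm, Nat.card_fin]

theorem stmt3 :
    1 / (2 * Real.log 2) ≤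
      Filter.liminf
        (fun n : ℕ => ((avoidCount2134 n : ℝ) / (Nat.factorial n : ℝ)) ^ ((n : ℝ)⁻¹))
        Filter.atTop := by
  have hL := Real.log_pos one_lt_two
  have ht := tendsto_pow_div_rpow_inv (c := 1 / (2 * Real.log 2)) (C := 4 * Real.exp 1)
    (by positivity) (by positivity)
  rw [← ht.liminf_eq]
  refine Filter.liminf_le_liminf ?_ ht.isBoundedUnder_ge ?_
  · filter_upwards [Filter.eventually_ge_atTop 2] with n hn
    exact Real.rpow_le_rpow (by positivity) (pow_div_le_avoidCount2134_div hn) (by positivity)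
  · refine (Filter.isBoundedUnder_of ⟨1, fun n => ?_⟩).isCoboundedUnder_ge
    refine Real.rpow_le_one (by positivity) ?_ (by positivity)
    rw [div_le_one (by positivity)]
    exact_mod_cast avoidCount2134_le_factorial n
end

section
/- lim_{n→∞} ( |C*_{n+1}| / n! )^{1/n} = 1/(2·log 2). -/
/-- `π` has a stretching pair: 1-indexed positions `1 ≤ i < j ≤ n` (here 0-indexed) with
`π(i) < i < j < π(j)`. -/
def HasStretchingPair {n : ℕ} (π : Equiv.Perm (Fin n)) : Prop :=
  ∃ i j : Fin n, π i < i ∧ i < j ∧ j < π j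

/-- `|C*_m|`: the number of `m`-cycles in `S_m` with no stretching pair. -/
noncomputable def cStarCard (m : ℕ) : ℕ :=
  Nat.card {π : Equiv.Perm (Fin m) //
    π.IsCycle ∧ π.support.card = m ∧ ¬ HasStretchingPair π}


/-- Position of `i` inside its block: the elements below `k` come first, in increasing order,
and the others follow in decreasing order. -/
def blockRank {n : ℕ} (k : ℕ) (i : Fin (n + 1)) : ℕ :=
  if (i : ℕ) < k then i else 2 * n + 1 - i

/-- The lexicographic sorting key attached to a block function `B`. -/
def blockKey {n : ℕ} (k : ℕ) {m : ℕ} (B : Fin (n + 1) → Fin m) (i : Fin (n + 1)) : ℕ ×ₗ ℕ :=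
  toLex ((B i : ℕ), blockRank k i)

/-- Every block has an element below `k` and an element at least `k`. -/
def IsBlocking {n : ℕ} (k : ℕ) {m : ℕ} (B : Fin (n + 1) → Fin m) : Prop :=
  (∀ v, ∃ i : Fin (n + 1), (i : ℕ) < k ∧ B i = v) ∧
    ∀ v, ∃ i : Fin (n + 1), ¬ (i : ℕ) < k ∧ B i = v

/-- The permutation listing the elements by increasing key. -/
def blockSort {n : ℕ} (k : ℕ) {m : ℕ} (B : Fin (n + 1) → Fin m) : Equiv.Perm (Fin (n + 1)) :=
  Tuple.sort (blockKey k B)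

/-- The cycle that sends each element to the next one in the order of the keys. -/
def blockCycle {n : ℕ} (k : ℕ) {m : ℕ} (B : Fin (n + 1) → Fin m) : Equiv.Perm (Fin (n + 1)) :=
  blockSort k B * finRotate (n + 1) * (blockSort k B)⁻¹

lemma blockRank_injective {n k : ℕ} : Function.Injective (blockRank (n := n) k) := by
  intro i j h
  have := i.isLt
  have := j.isLt
  unfold blockRank at h
  ext
  split_ifs at h <;> omega

lemma blockKey_injective {n k m : ℕ} (B : Fin (n + 1) → Fin m) :
    Function.Injective (blockKey k B) := by
  intro i j h
  exact blockRank_injective (congrArg (fun p => (ofLex p).2) h)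

lemma blockKey_lt_iff {n k m : ℕ} {B : Fin (n + 1) → Fin m} {i j : Fin (n + 1)} :
    blockKey k B i < blockKey k B j ↔ B i < B j ∨ B i = B j ∧ blockRank k i < blockRank k j := by
  simp [blockKey, Prod.Lex.toLex_lt_toLex, Fin.ext_iff]

lemma strictMono_blockSort {n k m : ℕ} (B : Fin (n + 1) → Fin m) :
    StrictMono (blockKey k B ∘ blockSort k B) :=
  (Tuple.monotone_sort _).strictMono_of_injective
    ((blockKey_injective B).comp (blockSort k B).injective)

lemma eq_blockSort {n k m : ℕ} {B : Fin (n + 1) → Fin m} {σ : Equiv.Perm (Fin (n + 1))}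
    (h : StrictMono (blockKey k B ∘ σ)) : σ = blockSort k B := by
  have := (h.range_inj (strictMono_blockSort (k := k) B)).1 (by
    rw [σ.surjective.range_comp, (blockSort k B).surjective.range_comp])
  ext t
  exact congrArg Fin.val (blockKey_injective B (congrFun this t))

lemma blockCycle_blockSort {n k m : ℕ} (B : Fin (n + 1) → Fin m) (t : Fin (n + 1)) :
    blockCycle k B (blockSort k B t) = blockSort k B (t + 1) := by
  simp [blockCycle]

lemma blockSort_zero {n k m : ℕ} {B : Fin (n + 1) → Fin m} (hB : IsBlocking k B) :
    (B (blockSort k B 0) : ℕ) = 0 ∧ (blockSort k B 0 : ℕ) < k := by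
  set σ := blockSort k B with hσ
  have hmin : ∀ i, i ≠ σ 0 → blockKey k B (σ 0) < blockKey k B i := by
    intro i hi
    obtain ⟨s, rfl⟩ := σ.surjective i
    exact strictMono_blockSort B (Fin.pos_iff_ne_zero.2 fun h => hi (h ▸ rfl))
  constructor
  · by_contra h
    have hm : 0 < m := (B 0).pos
    obtain ⟨i, -, hi⟩ := hB.1 ⟨0, hm⟩
    have hv : (B i : ℕ) = 0 := by rw [hi]
    rcases blockKey_lt_iff.1 (hmin i fun h' => h (h' ▸ hv)) with h1 | ⟨h1, -⟩
    · rw [Fin.lt_def] at h1; omega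
    · exact h (by rw [h1, hv])
  · by_contra h
    obtain ⟨i, hik, hi⟩ := hB.1 (B (σ 0))
    have h1 := blockKey_lt_iff.1 (hmin i fun h' => h (h' ▸ hik))
    rw [hi] at h1
    simp only [lt_irrefl, true_and, false_or] at h1
    have := (σ 0).isLt
    have := i.isLt
    unfold blockRank at h1
    split_ifs at h1; omega

/-- Consecutive elements in the order of the keys. -/
lemma blockSort_succ {n k m : ℕ} {B : Fin (n + 1) → Fin m} (hB : IsBlocking k B) (t : Fin n) :
    ((blockSort k B t.castSucc : ℕ) < k → blockSort k B t.castSucc < blockSort k B t.succ) ∧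
    (¬ (blockSort k B t.castSucc : ℕ) < k → blockSort k B t.succ < blockSort k B t.castSucc) ∧
    (B (blockSort k B t.succ) : ℕ) = B (blockSort k B t.castSucc) +
      if ¬ (blockSort k B t.castSucc : ℕ) < k ∧ (blockSort k B t.succ : ℕ) < k then 1 else 0 := by
  set σ := blockSort k B with hσ
  have hlt : blockKey k B (σ t.castSucc) < blockKey k B (σ t.succ) :=
    strictMono_blockSort B (Fin.castSucc_lt_succ)
  have hbet : ∀ i, blockKey k B i ≤ blockKey k B (σ t.castSucc) ∨
      blockKey k B (σ t.succ) ≤ blockKey k B i := by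
    intro i
    obtain ⟨s, rfl⟩ := σ.surjective i
    rcases le_or_gt s t.castSucc with h | h
    · exact Or.inl ((strictMono_blockSort B).monotone h)
    · exact Or.inr ((strictMono_blockSort B).monotone (Fin.castSucc_lt_iff_succ_le.1 h))
  generalize σ t.castSucc = x at *
  generalize σ t.succ = y at *
  simp only [← not_lt, blockKey_lt_iff] at hlt hbet
  have hx := x.isLt
  have hy := y.isLt
  have hstep : (B y : ℕ) ≤ B x + 1 := by
    by_contra h
    obtain ⟨i, -, hi⟩ := hB.1 ⟨B x + 1, by have := (B y).isLt; omega⟩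
    have := hbet i
    simp only [Fin.lt_def, Fin.ext_iff, hi] at this
    omega
  obtain ⟨i, hik, hi⟩ := hB.1 (B y)
  obtain ⟨j, hjk, hj⟩ := hB.2 (B x)
  have h1 := hbet i
  have h2 := hbet j
  have hiN := i.isLt
  have hjN := j.isLt
  simp only [hi, hj, Fin.lt_def, Fin.ext_iff, blockRank] at h1 h2 hlt ⊢
  by_cases hxk : (x : ℕ) < k <;> by_cases hyk : (y : ℕ) < k <;>
    simp only [hxk, hyk, hik, hjk, if_true, if_false, not_true_eq_false, not_false_eq_true,
      and_true, and_false, true_and, true_implies, false_implies] at h1 h2 hlt ⊢ <;> omega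

lemma blockCycle_excedance {n k m : ℕ} {B : Fin (n + 1) → Fin m} (hB : IsBlocking k B)
    (i : Fin (n + 1)) :
    ((i : ℕ) < k → i < blockCycle k B i) ∧ (¬ (i : ℕ) < k → blockCycle k B i < i) := by
  obtain ⟨t, rfl⟩ := (blockSort k B).surjective i
  rw [blockCycle_blockSort]
  rcases Fin.eq_castSucc_or_eq_last t with ⟨s, rfl⟩ | rfl
  · rw [Fin.coeSucc_eq_succ]
    exact ⟨(blockSort_succ hB s).1, (blockSort_succ hB s).2.1⟩
  · rw [Fin.last_add_one]
    have h0 := (blockSort_zero hB).2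
    have hlast : ¬ (blockSort k B (Fin.last n) : ℕ) < k := by
      intro h
      obtain ⟨j, hjk, hj⟩ := hB.2 (B (blockSort k B (Fin.last n)))
      obtain ⟨s, rfl⟩ := (blockSort k B).surjective j
      have h1 := (strictMono_blockSort (k := k) B).monotone (Fin.le_last s)
      have := (blockSort k B s).isLt
      have := (blockSort k B (Fin.last n)).isLt
      simp only [Function.comp, ← not_lt, blockKey_lt_iff, hj, lt_irrefl, true_and,
        false_or, blockRank, h, hjk, if_true, if_false] at h1
      omega
    exact ⟨fun h => absurd h hlast, fun h => by rw [Fin.lt_def]; omega⟩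

/-- The property counted by `cStarCard`. -/
def IsStarCycle {m : ℕ} (π : Equiv.Perm (Fin m)) : Prop :=
  π.IsCycle ∧ π.support.card = m ∧ ¬ HasStretchingPair π

lemma isStarCycle_blockCycle {n k m : ℕ} (hn : 1 ≤ n) {B : Fin (n + 1) → Fin m}
    (hB : IsBlocking k B) : IsStarCycle (blockCycle k B) := by
  obtain ⟨p, rfl⟩ := Nat.exists_eq_add_of_le' hn
  refine ⟨isCycle_finRotate.conj, ?_, ?_⟩
  · rw [blockCycle, Equiv.Perm.card_support_conj, support_finRotate]
    simp
  · rintro ⟨i, j, h1, h2, h3⟩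
    have hi := (blockCycle_excedance hB i).1
    have hj := (blockCycle_excedance hB j).2
    rw [Fin.lt_def] at *
    by_cases h : (i : ℕ) < k
    · have := hi h; omega
    · have := hj (by omega); omega

lemma blockSort_injective {n k m : ℕ} {B B' : Fin (n + 1) → Fin m} (hB : IsBlocking k B)
    (hB' : IsBlocking k B') (h : blockSort k B = blockSort k B') : B = B' := by
  have key : ∀ t, (B (blockSort k B t) : ℕ) = B' (blockSort k B t) := by
    intro t
    induction t using Fin.induction with
    | zero =>
      rw [(blockSort_zero hB).1, h, (blockSort_zero hB').1]
    | succ t ih =>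
      rw [(blockSort_succ hB t).2.2, h, (blockSort_succ hB' t).2.2, ← h, ih]
  funext i
  obtain ⟨t, rfl⟩ := (blockSort k B).surjective i
  exact Fin.ext (key t)

lemma card_blocking_le {n : ℕ} (hn : 1 ≤ n) (k m : ℕ) :
    Nat.card {B : Fin (n + 1) → Fin m // IsBlocking k B} ≤ (n + 1) * cStarCard (n + 1) := by
  have : Nat.card ({π : Equiv.Perm (Fin (n + 1)) // IsStarCycle π} × Fin (n + 1)) =
      (n + 1) * cStarCard (n + 1) := by
    rw [Nat.card_prod, Nat.card_fin, mul_comm]; rfl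
  rw [← this]
  refine Nat.card_le_card_of_injective
    (fun B => (⟨blockCycle k B.1, isStarCycle_blockCycle hn B.2⟩, blockSort k B.1 0)) ?_
  rintro ⟨B, hB⟩ ⟨B', hB'⟩ h
  simp only [Prod.mk.injEq, Subtype.mk.injEq] at h
  refine Subtype.ext (blockSort_injective hB hB' (Equiv.ext fun t => ?_))
  induction t using Fin.induction with
  | zero => exact h.2
  | succ t ih =>
    rw [← Fin.coeSucc_eq_succ, ← blockCycle_blockSort, ← blockCycle_blockSort, h.1, ih]

lemma IsStarCycle.exists_conj {n : ℕ} (hn : 1 ≤ n) {π : Equiv.Perm (Fin (n + 1))}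
    (hπ : IsStarCycle π) :
    ∃ σ : Equiv.Perm (Fin (n + 1)), σ 0 = 0 ∧ ∀ t, π (σ t) = σ (t + 1) := by
  obtain ⟨p, rfl⟩ := Nat.exists_eq_add_of_le' hn
  have hc : IsConj (finRotate (p + 1 + 1)) π := by
    rw [isCycle_finRotate.isConj_iff hπ.1, hπ.2.1, support_finRotate]
    simp
  obtain ⟨τ, hτ⟩ := isConj_iff.1 hc
  obtain ⟨s, hs⟩ := τ.surjective 0
  refine ⟨(Equiv.addRight s).trans τ, by simpa using hs, fun t => ?_⟩
  simp [← hτ, add_right_comm]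

lemma IsStarCycle.exists_threshold {n : ℕ} {π : Equiv.Perm (Fin (n + 1))}
    (hπ : IsStarCycle π) :
    ∃ k : ℕ, 1 ≤ k ∧ k ≤ n ∧ ∀ i : Fin (n + 1),
      ((i : ℕ) < k → i < π i) ∧ (¬ (i : ℕ) < k → π i < i) := by
  have hne : ∀ i, π i ≠ i := by
    intro i
    rw [← Equiv.Perm.mem_support, (Finset.card_eq_iff_eq_univ π.support).1 (by simpa using hπ.2.1)]
    exact Finset.mem_univ i
  have hex : ∃ k : ℕ, ∃ i : Fin (n + 1), (i : ℕ) = k ∧ π i < i :=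
    ⟨n, Fin.last n, rfl, lt_of_le_of_ne (Fin.le_last _) (hne _)⟩
  obtain ⟨i₀, h0, h1⟩ := Nat.find_spec hex
  refine ⟨Nat.find hex, ?_, ?_, fun i => ⟨fun h => ?_, fun h => ?_⟩⟩
  · have := Fin.lt_def.1 h1
    omega
  · have := i₀.isLt
    omega
  · exact lt_of_le_of_ne (not_lt.1 fun h' => Nat.find_min hex h ⟨i, rfl, h'⟩) (hne i).symm
  · refine lt_of_le_of_ne (not_lt.1 fun h' => ?_) (hne i)
    rcases eq_or_lt_of_le (show i₀ ≤ i by rw [Fin.le_def]; omega) with rfl | h2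
    · exact lt_asymm h1 h'
    · exact hπ.2.2 ⟨i₀, i, h1, h2, h'⟩

lemma IsStarCycle.exists_blocking {n : ℕ} (hn : 1 ≤ n) {π : Equiv.Perm (Fin (n + 1))}
    (hπ : IsStarCycle π) :
    ∃ k ∈ Finset.Icc 1 n, ∃ m ∈ Finset.range (n + 2), ∃ B : Fin (n + 1) → Fin m,
      IsBlocking k B ∧ blockCycle k B = π := by
  obtain ⟨σ, hσ0, hσ⟩ := hπ.exists_conj hn
  obtain ⟨k, hk1, hkn, hk⟩ := hπ.exists_threshold
  set a : ℕ → Fin (n + 1) := fun t => σ (Fin.ofNat (n + 1) t) with ha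
  have haS : ∀ t, a (t + 1) = π (a t) := fun t => by
    simp only [ha, hσ]
    congr 1
    ext
    simp [Fin.val_add]
  have haN : a (n + 1) = 0 := by
    rw [← hσ0]
    simp only [ha]
    congr 1
    ext
    simp
  have ha0 : a 0 = 0 := by simp [ha, hσ0]
  have haσ : ∀ t : Fin (n + 1), a t = σ t := fun t => by simp [ha]
  set p : ℕ → Prop := fun t => ¬ (a t : ℕ) < k ∧ (a (t + 1) : ℕ) < k with hp
  classical
  set b : ℕ → ℕ := fun t => Nat.count p t with hb
  have hbS : ∀ t, b (t + 1) = b t + if p t then 1 else 0 := fun t => Nat.count_succ p t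
  have hmono : Monotone b := Nat.count_monotone p
  have hpn : p n := by
    constructor
    · intro h
      have := (hk (a n)).1 h
      rw [← haS, haN] at this
      exact absurd this (Fin.not_lt_zero _)
    · rw [haN]; exact hk1
  have hbN : b (n + 1) = b n + 1 := by rw [hbS, if_pos hpn]
  have hlt : ∀ i, b (σ.symm i : ℕ) < b (n + 1) := fun i => by
    have := hmono (show (σ.symm i : ℕ) ≤ n by have := (σ.symm i).isLt; omega)
    omega
  have hlarge : ∀ t v, v < b t → ∃ s < t, ¬ (a s : ℕ) < k ∧ b s = v := by
    intro t
    induction t with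
    | zero => intro v hv; simp [hb] at hv
    | succ t ih =>
      intro v hv
      by_cases hvt : v < b t
      · obtain ⟨s, hs, h⟩ := ih v hvt
        exact ⟨s, by omega, h⟩
      · rw [hbS] at hv
        split_ifs at hv with h
        · exact ⟨t, by omega, h.1, by omega⟩
        · omega
  have hsmall : ∀ t v, v ≤ b t → ∃ s ≤ t, (a s : ℕ) < k ∧ b s = v := by
    intro t
    induction t with
    | zero =>
      intro v hv
      refine ⟨0, le_rfl, by rw [ha0]; exact hk1, ?_⟩
      simp [hb] at hv ⊢
      exact hv.symm
    | succ t ih =>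
      intro v hv
      by_cases hvt : v ≤ b t
      · obtain ⟨s, hs, h⟩ := ih v hvt
        exact ⟨s, by omega, h⟩
      · have h2 := hbS t
        split_ifs at h2 with h
        · exact ⟨t + 1, by omega, h.2, by omega⟩
        · omega
  have hasymm : ∀ s ≤ n, (σ.symm (a s) : ℕ) = s := fun s hs => by
    simp [ha, Nat.mod_eq_of_lt (Nat.lt_succ_of_le hs)]
  refine ⟨k, Finset.mem_Icc.2 ⟨hk1, hkn⟩, b (n + 1), ?_, fun i => ⟨b (σ.symm i : ℕ), hlt i⟩,
    ⟨fun v => ?_, fun v => ?_⟩, ?_⟩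
  · rw [Finset.mem_range]
    exact Nat.lt_succ_of_le (Nat.count_le p)
  · obtain ⟨s, hs, h1, h2⟩ := hsmall n v (by have := v.isLt; omega)
    exact ⟨a s, h1, Fin.ext (by simp only [hasymm s hs, h2])⟩
  · obtain ⟨s, hs, h1, h2⟩ := hlarge (n + 1) v v.isLt
    exact ⟨a s, h1, Fin.ext (by simp only [hasymm s (by omega), h2])⟩
  · have hsort := eq_blockSort (k := k)
      (B := fun i => (⟨b (σ.symm i : ℕ), hlt i⟩ : Fin (b (n + 1)))) (σ := σ) (by
        rw [Fin.strictMono_iff_lt_succ]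
        intro t
        simp only [Function.comp, blockKey_lt_iff, Fin.lt_def, Fin.ext_iff,
          Equiv.symm_apply_apply, Fin.val_castSucc, Fin.val_succ]
        have h1 := hbS t
        have h2 := hk (a t)
        rw [← haS] at h2
        have e1 : σ t.castSucc = a t := by rw [← haσ]; simp
        have e2 : σ t.succ = a (t + 1) := by rw [← haσ]; simp
        rw [e1, e2]
        have := (a t).isLt
        have := (a (t + 1)).isLt
        simp only [Fin.lt_def] at h2
        simp only [hp] at h1
        unfold blockRank
        split_ifs at h1 ⊢ <;> omega)
    ext i
    obtain ⟨t, rfl⟩ := σ.surjective i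
    have hc := blockCycle_blockSort (k := k)
      (fun i => (⟨b (σ.symm i : ℕ), hlt i⟩ : Fin (b (n + 1)))) t
    rw [← hsort] at hc
    rw [hc, hσ]

lemma cStarCard_le {n : ℕ} (hn : 1 ≤ n) :
    cStarCard (n + 1) ≤ ∑ k ∈ Finset.Icc 1 n, ∑ m ∈ Finset.range (n + 2),
      Nat.card {B : Fin (n + 1) → Fin m // IsBlocking k B} := by
  classical
  have hcard : cStarCard (n + 1) =
      (Finset.univ.filter fun π : Equiv.Perm (Fin (n + 1)) => IsStarCycle π).card := by
    rw [← Fintype.card_subtype, ← Nat.card_eq_fintype_card]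
    rfl
  have hsub : (Finset.univ.filter fun π : Equiv.Perm (Fin (n + 1)) => IsStarCycle π) ⊆
      (Finset.Icc 1 n).biUnion fun k => (Finset.range (n + 2)).biUnion fun m =>
        (Finset.univ.filter fun B : Fin (n + 1) → Fin m => IsBlocking k B).image
          (blockCycle k) := by
    intro π hπ
    obtain ⟨k, hk, m, hm, B, hB, rfl⟩ :=
      IsStarCycle.exists_blocking hn (Finset.mem_filter.1 hπ).2
    simp only [Finset.mem_biUnion, Finset.mem_image, Finset.mem_filter, Finset.mem_univ, true_and]
    exact ⟨k, hk, m, hm, B, hB, rfl⟩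
  rw [hcard]
  refine (Finset.card_le_card hsub).trans (Finset.card_biUnion_le.trans
    (Finset.sum_le_sum fun k _ => Finset.card_biUnion_le.trans
      (Finset.sum_le_sum fun m _ => Finset.card_image_le.trans ?_)))
  rw [← Fintype.card_subtype, ← Nat.card_eq_fintype_card]

/-- The number of surjections from a `k`-element set onto an `m`-element set. -/
noncomputable def surjCount (k m : ℕ) : ℕ :=
  Nat.card {f : Fin k → Fin m // Function.Surjective f}

lemma card_surjective {α β : Type*} [Finite α] [Finite β] :
    Nat.card {f : α → β // Function.Surjective f} = surjCount (Nat.card α) (Nat.card β) := by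
  refine Nat.card_congr (Equiv.subtypeEquiv
    (Equiv.arrowCongr (Finite.equivFin α) (Finite.equivFin β)) fun f => ?_)
  simp [Equiv.arrowCongr]

lemma card_blocking {n k : ℕ} (m : ℕ) (hk : k ≤ n + 1) :
    Nat.card {B : Fin (n + 1) → Fin m // IsBlocking k B} =
      surjCount k m * surjCount (n + 1 - k) m := by
  classical
  have h1 : Nat.card {i : Fin (n + 1) // (i : ℕ) < k} = k := by
    rw [Nat.card_eq_fintype_card, Fintype.card_subtype, Fin.card_filter_val_lt, min_eq_right hk]
  have h2 : Nat.card {i : Fin (n + 1) // ¬ (i : ℕ) < k} = n + 1 - k := by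
    rw [Nat.card_eq_fintype_card, Fintype.card_subtype_compl, ← Nat.card_eq_fintype_card,
      ← Nat.card_eq_fintype_card, h1, Nat.card_fin]
  have e : {B : Fin (n + 1) → Fin m // IsBlocking k B} ≃
      {f : {i : Fin (n + 1) // (i : ℕ) < k} → Fin m // Function.Surjective f} ×
      {f : {i : Fin (n + 1) // ¬ (i : ℕ) < k} → Fin m // Function.Surjective f} :=
    (Equiv.subtypeEquiv
      (Equiv.piEquivPiSubtypeProd (fun i : Fin (n + 1) => (i : ℕ) < k) fun _ => Fin m)
      (fun B => by
        simp [IsBlocking, Function.Surjective, Equiv.piEquivPiSubtypeProd])).trans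
      Equiv.subtypeProdEquivProd
  rw [Nat.card_congr e, Nat.card_prod, card_surjective, card_surjective, h1, h2, Nat.card_fin]

lemma card_eq_sum_card_fiber {α β : Type*} [Finite α] [Fintype β] (φ : α → β) :
    Nat.card α = ∑ b, Nat.card {a // φ a = b} := by
  rw [← Nat.card_sigma]
  exact (Nat.card_congr (Equiv.sigmaFiberEquiv φ)).symm

lemma exists_pow_le_surjCount (j k : ℕ) : ∃ m, j ^ k ≤ 2 ^ j * surjCount k m := by
  classical
  by_contra! h
  have hfib : ∀ T : Finset (Fin j),
      Nat.card {f : Fin k → Fin j // Finset.univ.image f = T} ≤ surjCount k T.card := by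
    intro T
    have hT : surjCount k T.card = Nat.card {f : Fin k → T // Function.Surjective f} := by
      rw [card_surjective]; simp
    rw [hT]
    refine Nat.card_le_card_of_injective (fun f => ⟨fun i => ⟨f.1 i, by
      simpa only [f.2] using Finset.mem_image_of_mem f.1 (Finset.mem_univ i)⟩, ?_⟩) ?_
    · rintro ⟨v, hv⟩
      rw [← f.2] at hv
      obtain ⟨i, -, hi⟩ := Finset.mem_image.1 hv
      exact ⟨i, Subtype.ext hi⟩
    · intro f g hfg
      ext i : 2
      exact congrArg Subtype.val (congrFun (congrArg Subtype.val hfg) i)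
  have hsum := card_eq_sum_card_fiber
    (fun f : Fin k → Fin j => (Finset.univ.image f : Finset (Fin j)))
  have hlt : ∑ T : Finset (Fin j), 2 ^ j *
      Nat.card {f : Fin k → Fin j // Finset.univ.image f = T} < ∑ _T : Finset (Fin j), j ^ k :=
    Finset.sum_lt_sum_of_nonempty Finset.univ_nonempty fun T _ =>
      (Nat.mul_le_mul_left _ (hfib T)).trans_lt (h T.card)
  rw [← Finset.mul_sum, ← hsum] at hlt
  simp at hlt

lemma surjCount_le_succ {k : ℕ} (hk : 1 ≤ k) (m : ℕ) : surjCount k m ≤ surjCount (k + 1) m := by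
  obtain ⟨p, rfl⟩ := Nat.exists_eq_add_of_le' hk
  have hr : Function.Surjective (Fin.predAbove (0 : Fin (p + 1)) : Fin (p + 1 + 1) → Fin (p + 1)) :=
    Fin.predAbove_surjective 0
  refine Nat.card_le_card_of_injective (fun f => ⟨f.1 ∘ Fin.predAbove 0, f.2.comp hr⟩) ?_
  intro f g hfg
  exact Subtype.ext (hr.injective_comp_right (congrArg Subtype.val hfg))

lemma surjCount_succ_le (k m : ℕ) :
    surjCount k (m + 1) ≤
      ∑ j ∈ Finset.range (k + 1), k.choose j * if j = 0 then 0 else surjCount (k - j) m := by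
  classical
  have hsum := card_eq_sum_card_fiber (fun f : {f : Fin k → Fin (m + 1) // Function.Surjective f} =>
    (Finset.univ.filter fun i => f.1 i = Fin.last m))
  have hpow := Finset.sum_powerset_apply_card
    (fun j => if j = 0 then 0 else surjCount (k - j) m) (x := (Finset.univ : Finset (Fin k)))
  simp only [Finset.powerset_univ, Finset.card_univ, Fintype.card_fin, smul_eq_mul] at hpow
  rw [surjCount, hsum, ← hpow]
  refine Finset.sum_le_sum fun S _ => ?_
  split_ifs with hS
  · rw [Finset.card_eq_zero] at hS
    subst hS
    refine (Nat.card_eq_zero.2 (Or.inl ⟨?_⟩)).le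
    rintro ⟨⟨f, hf⟩, h⟩
    obtain ⟨i, hi⟩ := hf (Fin.last m)
    exact Finset.notMem_empty i (h ▸ Finset.mem_filter.2 ⟨Finset.mem_univ i, hi⟩)
  · have hc : surjCount (k - S.card) m =
        Nat.card {g : {i // i ∉ S} → Fin m // Function.Surjective g} := by
      rw [card_surjective, Nat.card_eq_fintype_card, Fintype.card_subtype_compl]
      simp
    rw [hc]
    have hmem : ∀ (f : {f : {f : Fin k → Fin (m + 1) // Function.Surjective f} //
        (Finset.univ.filter fun i => f.1 i = Fin.last m) = S}) (i : Fin k),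
        i ∈ S ↔ f.1.1 i = Fin.last m := by
      rintro ⟨f, rfl⟩ i
      simp
    refine Nat.card_le_card_of_injective (fun f => ⟨fun i =>
      (f.1.1 i.1).castPred fun h => i.2 ((hmem f i.1).2 h), ?_⟩) ?_
    · intro v
      obtain ⟨i, hi⟩ := f.1.2 v.castSucc
      refine ⟨⟨i, fun h => (Fin.castSucc_lt_last v).ne (hi ▸ (hmem f i).1 h)⟩, ?_⟩
      simp [hi]
    · intro f g hfg
      ext i : 3
      by_cases hi : i ∈ S
      · rw [(hmem f i).1 hi, (hmem g i).1 hi]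
      · have := congrFun (congrArg Subtype.val hfg) ⟨i, hi⟩
        simpa using this

lemma surjCount_mul_pow_le (k m : ℕ) {x : ℝ} (hx : 0 ≤ x) :
    surjCount k m * x ^ k ≤ k.factorial * (Real.exp x - 1) ^ m := by
  have he : 0 ≤ Real.exp x - 1 := by linarith [Real.add_one_le_exp x]
  induction m generalizing k with
  | zero =>
    rcases k with _ | k
    · have : surjCount 0 0 ≤ 1 := by
        rw [surjCount]
        exact Finite.card_le_one_iff_subsingleton.2 inferInstance
      simpa using this
    · have : surjCount (k + 1) 0 = 0 := by
        rw [surjCount]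
        exact Nat.card_eq_zero.2 (Or.inl ⟨fun f => (f.1 0).elim0⟩)
      rw [this]
      simp
  | succ m ih =>
    have h1 : (surjCount k (m + 1) : ℝ) ≤ ∑ j ∈ Finset.range (k + 1),
        (k.choose j : ℝ) * if j = 0 then 0 else (surjCount (k - j) m : ℝ) := by
      exact_mod_cast surjCount_succ_le k m
    have h2 : ∀ j ∈ Finset.range (k + 1),
        ((k.choose j : ℝ) * if j = 0 then 0 else (surjCount (k - j) m : ℝ)) * x ^ k ≤
        (k.factorial * (Real.exp x - 1) ^ m) *
          (x ^ j / j.factorial - if j = 0 then 1 else 0) := by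
      intro j hj
      have hjk : j ≤ k := Nat.lt_succ_iff.1 (Finset.mem_range.1 hj)
      split_ifs with h0
      · simp [h0]
      · have hc : (k.factorial : ℝ) = k.choose j * j.factorial * (k - j).factorial := by
          exact_mod_cast (Nat.choose_mul_factorial_mul_factorial hjk).symm
        have hx' : x ^ k = x ^ j * x ^ (k - j) := by rw [← pow_add, Nat.add_sub_cancel' hjk]
        have hj0 : (j.factorial : ℝ) ≠ 0 := by positivity
        calc (k.choose j : ℝ) * surjCount (k - j) m * x ^ k
            = k.choose j * x ^ j * (surjCount (k - j) m * x ^ (k - j)) := by rw [hx']; ring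
          _ ≤ k.choose j * x ^ j * ((k - j).factorial * (Real.exp x - 1) ^ m) := by
              exact mul_le_mul_of_nonneg_left (ih (k - j)) (by positivity)
          _ = _ := by rw [hc]; field_simp; ring
    calc (surjCount k (m + 1) : ℝ) * x ^ k
        ≤ (∑ j ∈ Finset.range (k + 1),
            (k.choose j : ℝ) * if j = 0 then 0 else (surjCount (k - j) m : ℝ)) * x ^ k := by
          gcongr
      _ ≤ ∑ j ∈ Finset.range (k + 1), (k.factorial * (Real.exp x - 1) ^ m) *
          (x ^ j / j.factorial - if j = 0 then 1 else 0) := by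
          rw [Finset.sum_mul]
          exact Finset.sum_le_sum h2
      _ = (k.factorial * (Real.exp x - 1) ^ m) *
          (∑ j ∈ Finset.range (k + 1), x ^ j / j.factorial - 1) := by
          rw [← Finset.mul_sum, Finset.sum_sub_distrib]
          simp
      _ ≤ (k.factorial * (Real.exp x - 1) ^ m) * (Real.exp x - 1) := by
          gcongr
          exact Real.sum_le_exp_of_nonneg hx (k + 1)
      _ = _ := by ring

lemma pow_succ_mul_exp_one_le (k : ℕ) :
    (k : ℝ) ^ (k + 1) * Real.exp 1 ≤ ((k : ℝ) + 1) ^ (k + 1) := by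
  have h := Real.one_sub_div_pow_le_exp_neg (n := k + 1) (t := 1) (by push_cast; linarith)
  have h1 : (1 - 1 / ((k + 1 : ℕ) : ℝ)) = k / (k + 1) := by
    push_cast
    field_simp
    ring
  rw [h1, div_pow, Real.exp_neg, div_le_iff₀ (by positivity), inv_mul_eq_div,
    le_div_iff₀ (Real.exp_pos 1)] at h
  exact h

lemma factorial_mul_exp_le_s4 {k : ℕ} (hk : 1 ≤ k) :
    (k.factorial : ℝ) * Real.exp 1 ^ k ≤ Real.exp 1 * k * (k : ℝ) ^ k := by
  induction k, hk using Nat.le_induction with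
  | base => simp
  | succ k hk ih =>
    calc ((k + 1).factorial : ℝ) * Real.exp 1 ^ (k + 1)
        = (k + 1) * Real.exp 1 * (k.factorial * Real.exp 1 ^ k) := by
          rw [Nat.factorial_succ]; push_cast; ring
      _ ≤ (k + 1) * Real.exp 1 * (Real.exp 1 * k * (k : ℝ) ^ k) := by gcongr
      _ = (k + 1) * Real.exp 1 * ((k : ℝ) ^ (k + 1) * Real.exp 1) := by ring
      _ ≤ (k + 1) * Real.exp 1 * ((k : ℝ) + 1) ^ (k + 1) := by
          gcongr; exact pow_succ_mul_exp_one_le k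
      _ = _ := by push_cast; ring

lemma exp_sub_one_mul_exp_sub_one_le {x y : ℝ} (h : x + y = 2 * Real.log 2) :
    (Real.exp x - 1) * (Real.exp y - 1) ≤ 1 := by
  have h1 : Real.exp x * Real.exp y = 4 := by
    rw [← Real.exp_add, h, two_mul, Real.exp_add, Real.exp_log two_pos]
    norm_num
  have hx := Real.exp_pos x
  have hy := Real.exp_pos y
  nlinarith [sq_nonneg (Real.exp x - Real.exp y)]

lemma pow_self_le_exp_mul_factorial (n : ℕ) :
    (n : ℝ) ^ n ≤ Real.exp 1 ^ n * n.factorial := by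
  have h := Real.pow_div_factorial_le_exp (n : ℝ) (Nat.cast_nonneg n) n
  rw [div_le_iff₀ (by positivity)] at h
  rwa [← Real.exp_nat_mul, mul_one]

lemma two_mul_log_two_gt_one : 1 < 2 * Real.log 2 := by
  linarith [Real.log_two_gt_d9]

lemma surjCount_mul_surjCount_le {k l : ℕ} (hk : 1 ≤ k) (hl : 1 ≤ l) (m : ℕ) :
    (surjCount k m : ℝ) * surjCount l m * (2 * Real.log 2) ^ (k + l) ≤
      Real.exp 1 ^ 2 * (k + l : ℕ) ^ 2 * (k + l).factorial := by
  set c := 2 * Real.log 2 with hc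
  have hc0 : 0 < c := by linarith [two_mul_log_two_gt_one]
  have hk0 : (0 : ℝ) < k := by exact_mod_cast hk
  have hl0 : (0 : ℝ) < l := by exact_mod_cast hl
  set N : ℝ := k + l with hN
  have hN0 : 0 < N := by positivity
  set x := c * k / N with hx
  set y := c * l / N with hy
  have hx0 : 0 < x := by positivity
  have hy0 : 0 < y := by positivity
  have hxy : x + y = c := by rw [hx, hy]; field_simp; rw [hN]
  have hex : 0 ≤ Real.exp x - 1 := by linarith [Real.add_one_le_exp x]
  have hey : 0 ≤ Real.exp y - 1 := by linarith [Real.add_one_le_exp y]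
  have h1 := surjCount_mul_pow_le k m hx0.le
  have h2 := surjCount_mul_pow_le l m hy0.le
  have h3 : (surjCount k m * x ^ k) * (surjCount l m * y ^ l) ≤
      (k.factorial : ℝ) * l.factorial :=
    calc (surjCount k m * x ^ k) * (surjCount l m * y ^ l)
        ≤ (k.factorial * (Real.exp x - 1) ^ m) * (l.factorial * (Real.exp y - 1) ^ m) := by
          refine mul_le_mul h1 h2 (by positivity) (by positivity)
      _ = k.factorial * l.factorial * ((Real.exp x - 1) * (Real.exp y - 1)) ^ m := by
          rw [mul_pow]; ring
      _ ≤ k.factorial * l.factorial * 1 := by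
          gcongr
          exact pow_le_one₀ (mul_nonneg hex hey) (exp_sub_one_mul_exp_sub_one_le hxy)
      _ = _ := mul_one _
  have h4 : (surjCount k m : ℝ) * surjCount l m * c ^ (k + l) * ((k : ℝ) ^ k * (l : ℝ) ^ l) ≤
      k.factorial * l.factorial * N ^ (k + l) := by
    have : (surjCount k m : ℝ) * surjCount l m * c ^ (k + l) * ((k : ℝ) ^ k * (l : ℝ) ^ l) =
        (surjCount k m * x ^ k) * (surjCount l m * y ^ l) * N ^ (k + l) := by
      have hxk : c ^ k * (k : ℝ) ^ k = x ^ k * N ^ k := by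
        rw [← mul_pow, ← mul_pow, hx, div_mul_cancel₀ _ hN0.ne']
      have hyl : c ^ l * (l : ℝ) ^ l = y ^ l * N ^ l := by
        rw [← mul_pow, ← mul_pow, hy, div_mul_cancel₀ _ hN0.ne']
      calc (surjCount k m : ℝ) * surjCount l m * c ^ (k + l) * ((k : ℝ) ^ k * (l : ℝ) ^ l)
          = surjCount k m * surjCount l m * (c ^ k * (k : ℝ) ^ k) * (c ^ l * (l : ℝ) ^ l) := by
            rw [pow_add]; ring
        _ = _ := by rw [hxk, hyl, pow_add]; ring
    rw [this]
    gcongr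
  have h5 : (k.factorial : ℝ) * l.factorial * Real.exp 1 ^ (k + l) ≤
      Real.exp 1 ^ 2 * N ^ 2 * ((k : ℝ) ^ k * (l : ℝ) ^ l) :=
    calc (k.factorial : ℝ) * l.factorial * Real.exp 1 ^ (k + l)
        = (k.factorial * Real.exp 1 ^ k) * (l.factorial * Real.exp 1 ^ l) := by
          rw [pow_add]; ring
      _ ≤ (Real.exp 1 * k * (k : ℝ) ^ k) * (Real.exp 1 * l * (l : ℝ) ^ l) :=
          mul_le_mul (factorial_mul_exp_le_s4 hk) (factorial_mul_exp_le_s4 hl)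
            (by positivity) (by positivity)
      _ = Real.exp 1 ^ 2 * (k * l) * ((k : ℝ) ^ k * (l : ℝ) ^ l) := by ring
      _ ≤ _ := by gcongr; nlinarith
  have h6 := pow_self_le_exp_mul_factorial (k + l)
  push_cast at h6 ⊢
  rw [← hN] at h6 ⊢
  have hE : (0 : ℝ) < ((k : ℝ) ^ k * (l : ℝ) ^ l) * Real.exp 1 ^ (k + l) := by positivity
  refine le_of_mul_le_mul_right ?_ hE
  calc (surjCount k m : ℝ) * surjCount l m * c ^ (k + l) *
        (((k : ℝ) ^ k * (l : ℝ) ^ l) * Real.exp 1 ^ (k + l))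
      = (surjCount k m : ℝ) * surjCount l m * c ^ (k + l) * ((k : ℝ) ^ k * (l : ℝ) ^ l) *
        Real.exp 1 ^ (k + l) := by ring
    _ ≤ k.factorial * l.factorial * N ^ (k + l) * Real.exp 1 ^ (k + l) := by gcongr
    _ = k.factorial * l.factorial * Real.exp 1 ^ (k + l) * N ^ (k + l) := by ring
    _ ≤ Real.exp 1 ^ 2 * N ^ 2 * ((k : ℝ) ^ k * (l : ℝ) ^ l) *
        (Real.exp 1 ^ (k + l) * (k + l).factorial) :=
        mul_le_mul h5 h6 (by positivity) (by positivity)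
    _ = _ := by ring

lemma exp_one_lt_three : Real.exp 1 < 3 := by linarith [Real.exp_one_lt_d9]

lemma cStarCard_div_factorial_le {n : ℕ} (hn : 1 ≤ n) :
    (cStarCard (n + 1) : ℝ) / n.factorial ≤
      12 * ((n : ℝ) + 2) ^ 5 * ((2 * Real.log 2)⁻¹) ^ n := by
  set c := 2 * Real.log 2 with hc
  have hc1 : 1 < c := two_mul_log_two_gt_one
  have hterm : ∀ k ∈ Finset.Icc 1 n, ∀ m ∈ Finset.range (n + 2),
      (Nat.card {B : Fin (n + 1) → Fin m // IsBlocking k B} : ℝ) * c ^ (n + 1) ≤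
      Real.exp 1 ^ 2 * (n + 1 : ℕ) ^ 2 * (n + 1).factorial := by
    intro k hk m _
    obtain ⟨hk1, hkn⟩ := Finset.mem_Icc.1 hk
    have h := surjCount_mul_surjCount_le hk1 (show 1 ≤ n + 1 - k by omega) m
    rw [show k + (n + 1 - k) = n + 1 by omega] at h
    rw [card_blocking m (by omega)]
    exact_mod_cast h
  have hsum : (cStarCard (n + 1) : ℝ) * c ^ (n + 1) ≤
      n * ((n + 2) * (Real.exp 1 ^ 2 * (n + 1 : ℕ) ^ 2 * (n + 1).factorial)) := by
    have h : (cStarCard (n + 1) : ℝ) ≤ ∑ k ∈ Finset.Icc 1 n, ∑ m ∈ Finset.range (n + 2),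
        (Nat.card {B : Fin (n + 1) → Fin m // IsBlocking k B} : ℝ) := by
      exact_mod_cast cStarCard_le hn
    refine (mul_le_mul_of_nonneg_right h (by positivity)).trans ?_
    simp only [Finset.sum_mul]
    refine (Finset.sum_le_sum fun k hk => Finset.sum_le_sum fun m hm => hterm k hk m hm).trans ?_
    simp
  have he2 : Real.exp 1 ^ 2 ≤ 12 := by nlinarith [exp_one_lt_three, Real.exp_pos 1]
  rw [div_le_iff₀ (by positivity), inv_pow, mul_assoc, mul_comm _ (n.factorial : ℝ), ← mul_assoc,
    ← div_eq_mul_inv, le_div_iff₀ (by positivity)]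
  calc (cStarCard (n + 1) : ℝ) * c ^ n ≤ cStarCard (n + 1) * c ^ (n + 1) := by
        gcongr
        · exact hc1.le
        · omega
    _ ≤ _ := hsum
    _ = Real.exp 1 ^ 2 * (n * (n + 2) * (n + 1) ^ 3) * n.factorial := by
        rw [Nat.factorial_succ]; push_cast; ring
    _ ≤ 12 * ((n + 2) * (n + 2) * ((n : ℝ) + 2) ^ 3) * n.factorial := by
        gcongr <;> linarith
    _ = _ := by ring

lemma exists_le_surjCount (k : ℕ) :
    ∃ m, (k / Real.log 2) ^ k ≤ 2 * Real.exp 1 ^ k * (surjCount k m : ℝ) := by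
  have hL : 0 < Real.log 2 := Real.log_pos one_lt_two
  set j := ⌈k / Real.log 2⌉₊ with hj
  have hj1 : (k / Real.log 2 : ℝ) ≤ j := Nat.le_ceil _
  have hj2 : (j : ℝ) ≤ k / Real.log 2 + 1 := (Nat.ceil_lt_add_one (by positivity)).le
  obtain ⟨m, hm⟩ := exists_pow_le_surjCount j k
  refine ⟨m, ?_⟩
  have h2 : (2 : ℝ) ^ j ≤ 2 * Real.exp 1 ^ k := by
    calc (2 : ℝ) ^ j = Real.exp (Real.log 2 * j) := by
          rw [mul_comm, Real.exp_nat_mul, Real.exp_log two_pos]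
      _ ≤ Real.exp (Real.log 2 * (k / Real.log 2 + 1)) := by gcongr
      _ = Real.exp (Real.log 2 + k * 1) := by
          congr 1
          field_simp
          ring
      _ = _ := by rw [Real.exp_add, Real.exp_log two_pos, Real.exp_nat_mul]
  calc (k / Real.log 2) ^ k ≤ (j : ℝ) ^ k := by gcongr
    _ ≤ 2 ^ j * surjCount k m := by exact_mod_cast hm
    _ ≤ _ := by gcongr

lemma le_cStarCard_div_factorial {n : ℕ} (hn : 6 ≤ n) :
    (12 * ((n : ℝ) + 2) ^ 5)⁻¹ * ((2 * Real.log 2)⁻¹) ^ n ≤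
      (cStarCard (n + 1) : ℝ) / n.factorial := by
  have hL : 0 < Real.log 2 := Real.log_pos one_lt_two
  have he := Real.exp_pos 1
  set k := (n + 1) / 2 with hk
  obtain ⟨m, hm⟩ := exists_le_surjCount k
  have hl : surjCount k m ≤ surjCount (n + 1 - k) m := by
    rcases (by omega : n + 1 - k = k ∨ n + 1 - k = k + 1) with h | h <;> rw [h]
    exact surjCount_le_succ (by omega) m
  have hcount : (surjCount k m : ℝ) ^ 2 ≤ (n + 1) * cStarCard (n + 1) := by
    have h := card_blocking_le (show 1 ≤ n by omega) k m
    rw [card_blocking m (by omega)] at h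
    have h' := (Nat.mul_le_mul_left (surjCount k m) hl).trans h
    rw [sq]
    exact_mod_cast h'
  have hkn : (n : ℝ) ≤ 2 * k := by
    have : n ≤ 2 * k := by omega
    exact_mod_cast this
  have hn6 : (6 : ℝ) ≤ n := by exact_mod_cast hn
  set r := (n : ℝ) / (2 * Real.log 2 * Real.exp 1) with hr
  have hr1 : 1 ≤ r := by
    rw [hr, le_div_iff₀ (by positivity)]
    nlinarith [Real.log_two_lt_d9, exp_one_lt_three]
  have hrk : r ≤ k / Real.log 2 / Real.exp 1 := by
    rw [hr, div_div, div_le_div_iff₀ (by positivity) (by positivity)]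
    nlinarith [mul_pos hL he]
  have hs : r ^ k ≤ 2 * surjCount k m := by
    calc r ^ k ≤ (k / Real.log 2 / Real.exp 1) ^ k := by gcongr
      _ ≤ _ := by
        rw [div_pow, div_le_iff₀ (by positivity)]
        linarith
  have hrn : r ^ n ≤ 4 * ((n + 1) * cStarCard (n + 1)) := by
    calc r ^ n ≤ r ^ (k * 2) := pow_le_pow_right₀ hr1 (by omega)
      _ = (r ^ k) ^ 2 := pow_mul r k 2
      _ ≤ (2 * surjCount k m) ^ 2 := by gcongr
      _ = 4 * (surjCount k m : ℝ) ^ 2 := by ring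
      _ ≤ _ := by gcongr
  have hf : (n.factorial : ℝ) * ((2 * Real.log 2)⁻¹) ^ n ≤ Real.exp 1 * n * r ^ n := by
    rw [hr, div_pow, mul_pow _ (Real.exp 1), inv_pow, ← div_eq_mul_inv, mul_div_assoc',
      div_le_div_iff₀ (by positivity) (by positivity)]
    nlinarith [mul_le_mul_of_nonneg_left (factorial_mul_exp_le_s4 (show 1 ≤ n by omega))
      (show 0 ≤ (2 * Real.log 2) ^ n by positivity)]
  rw [le_div_iff₀ (by positivity), inv_mul_eq_div, div_mul_eq_mul_div,
    div_le_iff₀ (by positivity)]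
  calc ((2 * Real.log 2)⁻¹) ^ n * n.factorial ≤ Real.exp 1 * n * r ^ n := by linarith
    _ ≤ 3 * n * (4 * ((n + 1) * cStarCard (n + 1))) := by
        gcongr; exact exp_one_lt_three.le
    _ = cStarCard (n + 1) * (12 * (n * (n + 1))) := by ring
    _ ≤ cStarCard (n + 1) * (12 * ((n : ℝ) + 2) ^ 5) := by
        gcongr
        calc (n : ℝ) * (n + 1) ≤ (n + 2) * (n + 2) := by gcongr <;> linarith
          _ = ((n : ℝ) + 2) ^ 2 := by ring
          _ ≤ _ := pow_le_pow_right₀ (by linarith) (by norm_num)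

lemma tendsto_poly_rpow_inv :
    Filter.Tendsto (fun n : ℕ => (12 * ((n : ℝ) + 2) ^ 5) ^ ((n : ℝ)⁻¹))
      Filter.atTop (nhds 1) := by
  have h1 : Filter.Tendsto (fun n : ℕ => ((n : ℝ) + 2)) Filter.atTop Filter.atTop :=
    Filter.tendsto_atTop_add_const_right _ _ tendsto_natCast_atTop_atTop
  have h2 := (tendsto_rpow_div_mul_add 5 1 (-2) zero_ne_one).comp h1
  have h3 : Filter.Tendsto (fun n : ℕ => (12 : ℝ) ^ ((n : ℝ)⁻¹)) Filter.atTop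
      (nhds ((12 : ℝ) ^ (0 : ℝ))) :=
    tendsto_const_nhds.rpow (tendsto_inv_atTop_nhds_zero_nat (𝕜 := ℝ)) (Or.inl (by norm_num))
  have h4 := h3.mul h2
  rw [Real.rpow_zero, one_mul] at h4
  refine h4.congr fun n => ?_
  have h0 : (0 : ℝ) ≤ (n : ℝ) + 2 := by positivity
  rw [Real.mul_rpow (by norm_num) (by positivity), ← Real.rpow_natCast, ← Real.rpow_mul h0]
  simp [div_eq_mul_inv]

theorem stmt4 :
    Filter.Tendsto
      (fun n : ℕ => ((cStarCard (n + 1) : ℝ) / (Nat.factorial n : ℝ)) ^ ((n : ℝ)⁻¹))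
      Filter.atTop (nhds (1 / (2 * Real.log 2))) := by
  have hc : 0 < 2 * Real.log 2 := by linarith [two_mul_log_two_gt_one]
  have hpow : ∀ n : ℕ, 6 ≤ n →
      ((((2 * Real.log 2)⁻¹) ^ n : ℝ)) ^ ((n : ℝ)⁻¹) = (2 * Real.log 2)⁻¹ := fun n hn =>
    Real.pow_rpow_inv_natCast (by positivity) (by omega)
  have hup := tendsto_poly_rpow_inv.mul_const (2 * Real.log 2)⁻¹
  have hlow := (tendsto_poly_rpow_inv.inv₀ one_ne_zero).mul_const (2 * Real.log 2)⁻¹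
  rw [inv_one] at hlow
  rw [one_mul] at hup hlow
  rw [one_div]
  refine tendsto_of_tendsto_of_tendsto_of_le_of_le' hlow hup ?_ ?_
  · filter_upwards [Filter.eventually_ge_atTop 6] with n hn
    have h := Real.rpow_le_rpow (by positivity) (le_cStarCard_div_factorial hn)
      (show 0 ≤ (n : ℝ)⁻¹ by positivity)
    rwa [Real.mul_rpow (by positivity) (by positivity), hpow n hn,
      Real.inv_rpow (by positivity)] at h
  · filter_upwards [Filter.eventually_ge_atTop 6] with n hn
    have h := Real.rpow_le_rpow (by positivity)
      (cStarCard_div_factorial_le (show 1 ≤ n by omega)) (show 0 ≤ (n : ℝ)⁻¹ by positivity)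
    rwa [Real.mul_rpow (by positivity) (by positivity), hpow n hn] at h
end

section
/- For every positive integer n, [b^{⌊(n−1)/2⌋} a^{⌈(n−1)/2⌉}] ≤ |C*_{n+1}| ≤ n · [b^{⌊(n−1)/2⌋} a^{⌈(n−1)/2⌉}]. -/
/-- `[b^r a^s]` where `r + s = n - 1`: the number of permutations `π ∈ S_n` (on `Fin n`,
position `i : Fin n` representing the 1-indexed position `i + 1`) such that for every
`i ∈ {1, …, n-1}`, `π(i) > i` if and only if `i ≤ r`. -/
noncomputable def excWordCount (n r : ℕ) : ℕ :=
  Nat.card {π : Equiv.Perm (Fin n) //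
    ∀ i : Fin n, (i : ℕ) + 1 ≤ n - 1 → ((i : ℕ) + 1 ≤ r ↔ i < π i)}

open Finset

/-- Inserting a new largest element right after `p` in the cycle notation of `τ`
(as a fixed point when `p` is the new element itself). -/
def insertLast (n : ℕ) : Fin (n + 1) × Equiv.Perm (Fin n) ≃ Equiv.Perm (Fin (n + 1)) :=
  (Equiv.prodCongr finSuccEquivLast (Equiv.inv _)).trans <|
    Equiv.Perm.decomposeOption.symm.trans <|
      (Equiv.inv _).trans finSuccEquivLast.symm.permCongr

theorem optionCongr_inv_symm_apply {α : Type*} (τ : Equiv.Perm α) (x : Option α) :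
    (Equiv.optionCongr τ⁻¹).symm x = x.map τ := rfl

theorem insertLast_apply_self {n : ℕ} (p : Fin (n + 1)) (τ : Equiv.Perm (Fin n)) :
    insertLast n (p, τ) p = Fin.last n := by
  refine Fin.lastCases ?_ (fun q => ?_) p <;>
  simp [insertLast, Equiv.permCongr_apply, mul_inv_rev, optionCongr_inv_symm_apply]

theorem insertLast_apply_castSucc {n : ℕ} {p : Fin (n + 1)} {a : Fin n} (τ : Equiv.Perm (Fin n))
    (h : a.castSucc ≠ p) : insertLast n (p, τ) a.castSucc = (τ a).castSucc := by
  have h' : some a ≠ finSuccEquivLast p := by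
    rw [← finSuccEquivLast_castSucc]; exact fun e => h (finSuccEquivLast.injective e)
  simp [insertLast, Equiv.permCongr_apply, mul_inv_rev, optionCongr_inv_symm_apply,
    Equiv.swap_apply_of_ne_of_ne (Option.some_ne_none a) h']

theorem insertLast_castSucc_apply_last {n : ℕ} (q : Fin n) (τ : Equiv.Perm (Fin n)) :
    insertLast n (q.castSucc, τ) (Fin.last n) = (τ q).castSucc := by
  simp [insertLast, Equiv.permCongr_apply, mul_inv_rev, optionCongr_inv_symm_apply]

/-- The excedance set of `π`, as a set of natural numbers. -/
def excSet {n : ℕ} (π : Equiv.Perm (Fin n)) : Finset ℕ :=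
  ({i : Fin n | i < π i} : Finset (Fin n)).map Fin.valEmbedding

theorem mem_excSet {n : ℕ} {π : Equiv.Perm (Fin n)} {x : ℕ} :
    x ∈ excSet π ↔ ∃ i : Fin n, i < π i ∧ (i : ℕ) = x := by
  simp [excSet]

theorem excSet_insertLast_last {n : ℕ} (τ : Equiv.Perm (Fin n)) :
    excSet (insertLast n (Fin.last n, τ)) = excSet τ := by
  ext x
  simp only [mem_excSet, Fin.exists_fin_succ', insertLast_apply_self, lt_irrefl, false_and,
    or_false, insertLast_apply_castSucc τ (Fin.castSucc_ne_last _), Fin.castSucc_lt_castSucc_iff,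
    Fin.val_castSucc]

theorem excSet_insertLast_castSucc {n : ℕ} (q : Fin n) (τ : Equiv.Perm (Fin n)) :
    excSet (insertLast n (q.castSucc, τ)) = insert (q : ℕ) (excSet τ) := by
  ext x
  simp only [mem_excSet, Fin.exists_fin_succ', mem_insert, Fin.val_castSucc,
    Fin.not_lt.2 (Fin.le_last _), false_and, or_false]
  constructor
  · rintro ⟨i, hi, rfl⟩
    rcases eq_or_ne i q with rfl | h
    · exact Or.inl rfl
    · rw [insertLast_apply_castSucc τ (by simpa using h), Fin.castSucc_lt_castSucc_iff] at hi
      exact Or.inr ⟨i, hi, rfl⟩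
  · rintro (rfl | ⟨i, hi, rfl⟩)
    · exact ⟨q, by simp [insertLast_apply_self, Fin.castSucc_lt_last], rfl⟩
    · rcases eq_or_ne i q with rfl | h
      · exact ⟨i, by simp [insertLast_apply_self, Fin.castSucc_lt_last], rfl⟩
      · refine ⟨i, ?_, rfl⟩
        rwa [insertLast_apply_castSucc τ (by simpa using h), Fin.castSucc_lt_castSucc_iff]

/-- Every nonempty subset closed under `c` is everything. -/
def IsFullCycle {n : ℕ} (c : Equiv.Perm (Fin n)) : Prop :=
  ∀ S : Set (Fin n), S.Nonempty → (∀ x ∈ S, c x ∈ S) → S = Set.univ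

theorem IsFullCycle.apply_ne {n : ℕ} {c : Equiv.Perm (Fin (n + 2))} (h : IsFullCycle c)
    (x : Fin (n + 2)) : c x ≠ x := by
  intro hx
  have hS := h {x} ⟨x, rfl⟩ (by simp [hx])
  obtain ⟨y, hy⟩ := exists_ne x
  exact hy (by simpa using hS.ge (Set.mem_univ y))

theorem isCycle_and_card_support_iff {n : ℕ} (c : Equiv.Perm (Fin (n + 2))) :
    c.IsCycle ∧ c.support.card = n + 2 ↔ IsFullCycle c := by
  constructor
  · rintro ⟨hc, hcard⟩ S ⟨x, hx⟩ hS
    have hsupp : c.support = univ := (card_eq_iff_eq_univ _).1 (by simpa using hcard)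
    have hne (y : Fin (n + 2)) : c y ≠ y := by
      rw [← Equiv.Perm.mem_support, hsupp]; exact mem_univ y
    refine Set.eq_univ_of_forall fun y => ?_
    obtain ⟨k, rfl⟩ := hc.exists_pow_eq (hne x) (hne y)
    clear hcard
    induction k with
    | zero => simpa
    | succ k ih => rw [pow_succ']; exact hS _ ih
  · intro h
    refine ⟨⟨0, h.apply_ne 0, fun y _ => ?_⟩, ?_⟩
    · have hS := h {y | ∃ k : ℕ, (c ^ k) 0 = y} ⟨0, 0, rfl⟩ (by
        rintro _ ⟨k, rfl⟩
        exact ⟨k + 1, by rw [pow_succ']; rfl⟩)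
      obtain ⟨k, hk⟩ := hS.ge (Set.mem_univ y)
      exact ⟨k, by simpa using hk⟩
    · have : c.support = univ := by
        ext x; simpa using h.apply_ne x
      simp [this]

theorem not_isFullCycle_insertLast_last {n : ℕ} (c : Equiv.Perm (Fin (n + 1))) :
    ¬ IsFullCycle (insertLast (n + 1) (Fin.last _, c)) :=
  fun h => h.apply_ne _ (insertLast_apply_self _ _)

theorem isFullCycle_insertLast_castSucc {n : ℕ} (q : Fin n) (c : Equiv.Perm (Fin n)) :
    IsFullCycle (insertLast n (q.castSucc, c)) ↔ IsFullCycle c := by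
  constructor
  · intro h T ⟨b, hb⟩ hT
    have hS := h {x | (∃ a ∈ T, a.castSucc = x) ∨ (Fin.last n = x ∧ q ∈ T)}
      ⟨b.castSucc, Or.inl ⟨b, hb, rfl⟩⟩ (by
        rintro _ (⟨a, ha, rfl⟩ | ⟨rfl, hq⟩)
        · rcases eq_or_ne a q with rfl | hne
          · exact Or.inr ⟨(insertLast_apply_self _ _).symm, ha⟩
          · rw [insertLast_apply_castSucc c (by simpa using hne)]
            exact Or.inl ⟨_, hT a ha, rfl⟩
        · rw [insertLast_castSucc_apply_last]
          exact Or.inl ⟨_, hT q hq, rfl⟩)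
    refine Set.eq_univ_of_forall fun a => ?_
    rcases hS.ge (Set.mem_univ a.castSucc) with ⟨a', ha', e⟩ | ⟨e, -⟩
    · rwa [← Fin.castSucc_injective _ e]
    · exact absurd e.symm (Fin.castSucc_ne_last a)
  · intro h S hne hS
    have hlast (hq : q.castSucc ∈ S) : Fin.last n ∈ S := by
      simpa [insertLast_apply_self] using hS _ hq
    have hT := h {a | a.castSucc ∈ S} (by
        obtain ⟨x, hx⟩ := hne
        induction x using Fin.lastCases with
        | last => exact ⟨c q, by simpa [insertLast_castSucc_apply_last] using hS _ hx⟩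
        | cast a => exact ⟨a, hx⟩) (by
        intro a ha
        rcases eq_or_ne a q with rfl | hne
        · simpa [insertLast_castSucc_apply_last] using hS _ (hlast ha)
        · simpa [insertLast_apply_castSucc c (show a.castSucc ≠ q.castSucc by simpa using hne)]
            using hS _ ha)
    refine Set.eq_univ_of_forall fun x => ?_
    induction x using Fin.lastCases with
    | last => exact hlast (hT.ge (Set.mem_univ q))
    | cast a => exact hT.ge (Set.mem_univ a)

theorem excSet_subset_range {n : ℕ} (π : Equiv.Perm (Fin n)) : excSet π ⊆ range n := by
  intro x hx
  obtain ⟨i, -, rfl⟩ := mem_excSet.1 hx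
  exact mem_range.2 i.2

/-- The sum of `Φ` over the excedance sets of all permutations in `S_n`. -/
def excSum (n : ℕ) (Φ : Finset ℕ → ℕ) : ℕ := ∑ π : Equiv.Perm (Fin n), Φ (excSet π)

/-- The sum of `Φ` over `X` and the sets obtained from `X` by inserting some `i < n`. -/
def insertSum (n : ℕ) (Φ : Finset ℕ → ℕ) (X : Finset ℕ) : ℕ :=
  Φ X + ∑ i ∈ range n, Φ (insert i X)

theorem excSum_zero (Φ : Finset ℕ → ℕ) : excSum 0 Φ = Φ ∅ := by
  simp only [excSum, Fintype.sum_unique]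
  congr 1

theorem excSum_succ (n : ℕ) (Φ : Finset ℕ → ℕ) :
    excSum (n + 1) Φ = excSum n (insertSum n Φ) := by
  simp only [excSum, insertSum]
  rw [← (insertLast n).sum_comp, Fintype.sum_prod_type, Fin.sum_univ_castSucc, sum_comm,
    ← sum_add_distrib]
  refine sum_congr rfl fun π _ => ?_
  rw [add_comm, excSet_insertLast_last, sum_range]
  simp only [excSet_insertLast_castSucc]

theorem excSum_congr {n : ℕ} {Φ Ψ : Finset ℕ → ℕ} (h : ∀ X ⊆ range n, Φ X = Ψ X) :
    excSum n Φ = excSum n Ψ :=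
  sum_congr rfl fun π _ => h _ (excSet_subset_range π)

theorem excSum_add (n : ℕ) (Φ Ψ : Finset ℕ → ℕ) :
    excSum n (fun X => Φ X + Ψ X) = excSum n Φ + excSum n Ψ := sum_add_distrib

theorem excSum_mul (n a : ℕ) (Φ : Finset ℕ → ℕ) :
    excSum n (fun X => a * Φ X) = a * excSum n Φ := (mul_sum _ _ _).symm

theorem excSum_sum (n : ℕ) (s : Finset ℕ) (Φ : ℕ → Finset ℕ → ℕ) :
    excSum n (fun X => ∑ m ∈ s, Φ m X) = ∑ m ∈ s, excSum n (Φ m) := sum_comm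

/-- Remove `0` and lower every other element by one. -/
noncomputable def shiftDown (X : Finset ℕ) : Finset ℕ := X.preimage Nat.succ Nat.succ_injective.injOn

theorem shiftDown_insert_zero (X : Finset ℕ) : shiftDown (insert 0 X) = shiftDown X := by
  ext; simp [shiftDown]

theorem shiftDown_insert_succ (i : ℕ) (X : Finset ℕ) :
    shiftDown (insert (i + 1) X) = insert i (shiftDown X) := by
  ext; simp [shiftDown]

open Classical in
theorem sum_isFullCycle_eq_excSum (n : ℕ) (Φ : Finset ℕ → ℕ) :
    ∑ c : Equiv.Perm (Fin (n + 1)), (if IsFullCycle c then Φ (shiftDown (excSet c)) else 0) =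
      excSum n Φ := by
  induction n generalizing Φ with
  | zero =>
    have : Subsingleton (Fin (0 + 1)) := inferInstanceAs (Subsingleton (Fin 1))
    rw [excSum_zero, Fintype.sum_subsingleton _ 1,
      if_pos (show IsFullCycle _ from fun S hS _ => Subsingleton.eq_univ_of_nonempty hS)]
    congr 1
    ext x
    simp [shiftDown, mem_excSet]
  | succ n ih =>
    rw [excSum_succ, ← ih, ← (insertLast (n + 1)).sum_comp, Fintype.sum_prod_type,
      Fin.sum_univ_castSucc, sum_comm]
    simp only [not_isFullCycle_insertLast_last, isFullCycle_insertLast_castSucc,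
      excSet_insertLast_castSucc, if_false, sum_const_zero, add_zero]
    refine sum_congr rfl fun c _ => ?_
    split_ifs
    · rw [Fin.sum_univ_succ, insertSum, sum_range]
      simp only [Fin.val_zero, Fin.val_succ, shiftDown_insert_zero, shiftDown_insert_succ]
    · simp

theorem insertSum_ite_card {n r : ℕ} (h : r ≤ n) (φ : ℕ → ℕ) (X : Finset ℕ) :
    insertSum n (fun Y => if Y ⊆ range r then φ #Y else 0) X =
      if X ⊆ range r then (1 + #X) * φ #X + (r - #X) * φ (#X + 1) else 0 := by
  simp only [insertSum, insert_subset_iff]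
  split_ifs with hX
  · have h1 : (range n).filter (· ∈ range r) = range r := by
      ext i; simp only [mem_filter, mem_range]; omega
    simp only [hX, and_true]
    have h2 : ∑ i ∈ range r \ X, φ #(insert i X) = (r - #X) * φ (#X + 1) := by
      rw [sum_congr rfl fun i hi => congrArg φ (card_insert_of_notMem (mem_sdiff.1 hi).2),
        sum_const, card_sdiff_of_subset hX, card_range, smul_eq_mul]
    have h3 : ∑ i ∈ X, φ #(insert i X) = #X * φ #X := by
      rw [sum_congr rfl fun i hi => congrArg (fun Y => φ #Y) (insert_eq_self.2 hi),
        sum_const, smul_eq_mul]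
    rw [← sum_filter, h1, ← sum_sdiff hX, h2, h3]
    ring
  · simp [hX]

theorem choose_recurrence {r m j c : ℕ} (hr : m + j = r) (hc : c ≤ r) :
    (1 + c) * c.choose j + (r - c) * (c + 1).choose j = (m + 1) * (c + 1).choose j := by
  rcases le_or_gt j (c + 1) with hj | hj
  · rw [add_comm 1 c, mul_comm, Nat.choose_mul_succ_eq, mul_comm, ← add_mul]
    congr 1
    omega
  · rw [Nat.choose_eq_zero_of_lt hj, Nat.choose_eq_zero_of_lt (by omega : c < j)]
    simp

/-- Frobenius' identity between Eulerian and Stirling numbers. -/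
theorem excSum_choose (n : ℕ) : ∀ m j : ℕ, m + j = n →
    excSum n (fun X => (#X).choose j) = m.factorial * n.stirlingSecond m := by
  induction n with
  | zero =>
    intro m j h
    obtain ⟨rfl, rfl⟩ : m = 0 ∧ j = 0 := by omega
    simp [excSum_zero]
  | succ n ih =>
    intro m j h
    have key (X) (hX : X ⊆ range n) : insertSum n (fun Y => (#Y).choose j) X =
        m * (#X + 1).choose j := by
      have hcard : #X ≤ n := by simpa using card_le_card hX
      have h1 : insertSum n (fun Y => (#Y).choose j) X =
          (1 + #X) * (#X).choose j + (n - #X) * (#X + 1).choose j := by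
        have h := insertSum_ite_card le_rfl (fun c => c.choose j) X (n := n)
        rw [if_pos hX] at h
        rw [← h, insertSum, insertSum, if_pos hX]
        congr 1
        exact sum_congr rfl fun i hi => (if_pos (insert_subset hi hX)).symm
      rw [h1]
      rcases m with - | m
      · rw [Nat.choose_eq_zero_of_lt (by omega : #X < j)]
        rcases hcard.eq_or_lt with e | hlt
        · simp [e]
        · rw [Nat.choose_eq_zero_of_lt (by omega : #X + 1 < j)]; simp
      · exact choose_recurrence (by omega) hcard
    rw [excSum_succ, excSum_congr key, excSum_mul]
    rcases m with - | m
    · simp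
    · rw [Nat.stirlingSecond_succ_succ, Nat.factorial_succ]
      rcases j with - | j
      · simp only [Nat.choose_zero_right]
        have h0 := ih m 0 (by omega)
        simp only [Nat.choose_zero_right] at h0
        rw [h0, Nat.stirlingSecond_eq_zero_of_lt (by omega : n < m + 1)]
        ring
      · simp only [Nat.choose_succ_succ' _ j]
        rw [excSum_add, ih (m + 1) j (by omega), ih m (j + 1) (by omega), Nat.factorial_succ]
        ring

/-- The number of maps from a set of size `t` to `Option (Fin r)` whose image contains `r - c`
prescribed elements of `Fin r`, sorted by the image. -/
def coverCount (r t c : ℕ) : ℕ :=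
  ∑ m ∈ range (r + 1), m.factorial * (t + 1).stirlingSecond (m + 1) * c.choose (r - m)

theorem coverCount_zero (r c : ℕ) : coverCount r 0 c = c.choose r := by
  rw [coverCount, sum_range_succ']
  simp [Nat.stirlingSecond_eq_zero_of_lt, Nat.stirlingSecond_self]

theorem coverCount_succ {r c : ℕ} (t : ℕ) (hc : c ≤ r) :
    coverCount r (t + 1) c = (1 + c) * coverCount r t c + (r - c) * coverCount r t (c + 1) := by
  have h1 : (1 + c) * coverCount r t c + (r - c) * coverCount r t (c + 1) =
      ∑ m ∈ range (r + 1), m.factorial * (t + 1).stirlingSecond (m + 1) *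
        ((m + 1) * (c + 1).choose (r - m)) := by
    rw [coverCount, coverCount, mul_sum, mul_sum, ← sum_add_distrib]
    refine sum_congr rfl fun m hm => ?_
    rw [← choose_recurrence (Nat.add_sub_of_le (Nat.lt_succ_iff.1 (mem_range.1 hm))) hc]
    ring
  have h2 : coverCount r (t + 1) c =
      ∑ m ∈ range (r + 1), m.factorial * (t + 1).stirlingSecond (m + 1) *
        ((m + 1) * c.choose (r - m)) +
      ∑ m ∈ range (r + 1), m.factorial * (t + 1).stirlingSecond m * c.choose (r - m) := by
    rw [coverCount, ← sum_add_distrib]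
    refine sum_congr rfl fun m _ => ?_
    rw [Nat.stirlingSecond_succ_succ (t + 1) m]
    ring
  rw [h1, h2, sum_range_succ' (fun m => m.factorial * (t + 1).stirlingSecond m * _),
    sum_range_succ, sum_range_succ _ r, Nat.stirlingSecond_succ_zero]
  simp only [Nat.sub_self, Nat.choose_zero_right, mul_zero, zero_mul, add_zero]
  rw [add_right_comm, ← sum_add_distrib]
  congr 1
  refine sum_congr rfl fun m hm => ?_
  obtain ⟨j, hj⟩ : ∃ j, r - m = j + 1 := ⟨r - m - 1, by have := mem_range.1 hm; omega⟩
  rw [hj, Nat.choose_succ_succ' c j, show r - (m + 1) = j by omega, Nat.factorial_succ]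
  ring

theorem excSum_coverCount (r t : ℕ) : ∀ u : ℕ,
    excSum (r + t) (fun X => if X ⊆ range r then coverCount r u #X else 0) =
      excSum r (fun X => coverCount r (u + t) #X) := by
  induction t with
  | zero => exact fun u => excSum_congr fun X hX => if_pos hX
  | succ t ih =>
    intro u
    rw [← add_assoc, excSum_succ, show u + (t + 1) = u + 1 + t by ring, ← ih]
    congr 1
    funext X
    rw [insertSum_ite_card (Nat.le_add_right r t)]
    split_ifs with hX
    · exact (coverCount_succ u (by simpa using card_le_card hX)).symm
    · rfl

/-- The number of permutations in `S_{r+t}` with excedance set `{0, …, r-1}`. -/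
theorem excSum_eq_range (r t : ℕ) :
    excSum (r + t) (fun X => if X = range r then 1 else 0) =
      ∑ m ∈ range (r + 1), m.factorial * (t + 1).stirlingSecond (m + 1) *
        (m.factorial * r.stirlingSecond m) := by
  have h0 : (fun X => if X = range r then 1 else 0) =
      fun X => if X ⊆ range r then coverCount r 0 #X else 0 := by
    funext X
    rw [coverCount_zero]
    rcases eq_or_ne X (range r) with rfl | hne
    · simp
    · rw [if_neg hne]
      split_ifs with hX
      · have := card_lt_card (hX.ssubset_of_ne hne)
        rw [card_range] at this
        exact (Nat.choose_eq_zero_of_lt this).symm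
      · rfl
  rw [h0, excSum_coverCount, zero_add]
  simp only [coverCount]
  rw [excSum_sum]
  refine sum_congr rfl fun m hm => ?_
  rw [excSum_mul, excSum_choose r m (r - m) (by have := mem_range.1 hm; omega)]

/-- The `r ↔ s` symmetric form of the number of permutations in `S_{r+s+1}` with excedance set
`{0, …, r-1}`, summed up to `N`. -/
def stirlingPairing (N r s : ℕ) : ℕ :=
  ∑ m ∈ range N, m.factorial * (m + 1).factorial *
    ((r + 1).stirlingSecond (m + 1) * (s + 1).stirlingSecond (m + 1))

theorem stirlingPairing_comm (N r s : ℕ) : stirlingPairing N r s = stirlingPairing N s r := by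
  simp only [stirlingPairing, mul_comm ((r + 1).stirlingSecond _)]

theorem stirlingPairing_eq_of_lt {N r : ℕ} (s : ℕ) (h : r < N) :
    stirlingPairing N r s = stirlingPairing (r + 1) r s := by
  refine (sum_subset (range_subset_range.2 h) fun m _ hm => ?_).symm
  rw [Nat.stirlingSecond_eq_zero_of_lt (by simpa using hm : r + 1 < m + 1)]
  simp

theorem excSum_eq_stirlingPairing {N r : ℕ} (s : ℕ) (h : r < N) :
    excSum (r + (s + 1)) (fun X => if X = range r then 1 else 0) = stirlingPairing N r s := by
  rw [excSum_eq_range, stirlingPairing_eq_of_lt s h, stirlingPairing]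
  have h1 : ∑ m ∈ range (r + 1), m.factorial * (s + 1 + 1).stirlingSecond (m + 1) *
      (m.factorial * r.stirlingSecond m) =
      ∑ m ∈ range (r + 1), m.factorial * (m + 1).factorial *
        ((s + 1).stirlingSecond (m + 1) * r.stirlingSecond m) +
      ∑ m ∈ range (r + 1), m.factorial * m.factorial *
        ((s + 1).stirlingSecond m * r.stirlingSecond m) := by
    rw [← sum_add_distrib]
    refine sum_congr rfl fun m _ => ?_
    rw [Nat.stirlingSecond_succ_succ (s + 1) m, Nat.factorial_succ]
    ring
  have h2 : ∑ m ∈ range (r + 1), m.factorial * m.factorial *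
        ((s + 1).stirlingSecond m * r.stirlingSecond m) =
      ∑ m ∈ range (r + 1), (m + 1).factorial * (m + 1).factorial *
        ((s + 1).stirlingSecond (m + 1) * r.stirlingSecond (m + 1)) := by
    rw [sum_range_succ', sum_range_succ _ r, Nat.stirlingSecond_succ_zero,
      Nat.stirlingSecond_eq_zero_of_lt (Nat.lt_succ_self r)]
    simp
  rw [h1, h2, ← sum_add_distrib]
  refine sum_congr rfl fun m _ => ?_
  rw [Nat.stirlingSecond_succ_succ r m, Nat.factorial_succ]
  ring

theorem stirlingSecond_minor_nonneg : ∀ {r s j k : ℕ}, r ≤ s → j ≤ k →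
    r.stirlingSecond k * s.stirlingSecond j ≤ r.stirlingSecond j * s.stirlingSecond k
  | r, s, j, k, hrs, hjk => by
    rcases hjk.eq_or_lt with rfl | hlt
    · exact le_rfl
    obtain ⟨k, rfl⟩ : ∃ k', k = k' + 1 := ⟨k - 1, by omega⟩
    rcases r with - | r
    · simp
    obtain ⟨s, rfl⟩ : ∃ s', s = s' + 1 := ⟨s - 1, by omega⟩
    rcases j with - | j
    · simp
    have hrs' : r ≤ s := by omega
    have h1 := stirlingSecond_minor_nonneg hrs' hjk
    have h2 := stirlingSecond_minor_nonneg hrs' (show j ≤ k + 1 by omega)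
    have h3 := stirlingSecond_minor_nonneg hrs' (show j + 1 ≤ k by omega)
    have h4 := stirlingSecond_minor_nonneg hrs' (show j ≤ k by omega)
    simp only [Nat.stirlingSecond_succ_succ]
    have h1' := Nat.mul_le_mul_left ((j + 1) * (k + 1)) h1
    have h2' := Nat.mul_le_mul_left (k + 1) h2
    have h3' := Nat.mul_le_mul_left (j + 1) h3
    linarith

theorem stirlingPairing_le_succ (N : ℕ) {r s : ℕ} (h : r ≤ s) :
    stirlingPairing N r (s + 1) ≤ stirlingPairing N (r + 1) s := by
  refine sum_le_sum fun m _ => Nat.mul_le_mul_left _ ?_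
  rw [Nat.stirlingSecond_succ_succ (s + 1), Nat.stirlingSecond_succ_succ (r + 1)]
  have := stirlingSecond_minor_nonneg (Nat.succ_le_succ h) (Nat.le_succ m)
  simp only [Nat.succ_eq_add_one] at this
  linarith

theorem stirlingPairing_le_middle (N n : ℕ) {r : ℕ} (h : r ≤ n) :
    stirlingPairing N r (n - r) ≤ stirlingPairing N (n / 2) (n - n / 2) := by
  have low {r : ℕ} (hr : r ≤ n / 2) :
      stirlingPairing N r (n - r) ≤ stirlingPairing N (n / 2) (n - n / 2) := by
    induction hr using Nat.decreasingInduction with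
    | self => exact le_rfl
    | of_succ k hk ih =>
      refine le_trans ?_ ih
      rw [show n - k = n - (k + 1) + 1 by omega]
      exact stirlingPairing_le_succ N (by omega)
  rcases le_or_gt r (n / 2) with hr | hr
  · exact low hr
  · rw [stirlingPairing_comm]
    have := low (show n - r ≤ n / 2 by omega)
    rwa [Nat.sub_sub_self h] at this

theorem excWordCount_eq_excSum {n r : ℕ} (h : r < n) :
    excWordCount n r = excSum n (fun X => if X = range r then 1 else 0) := by
  classical
  rw [excWordCount, Nat.card_eq_fintype_card, Fintype.card_subtype, card_filter, excSum]
  refine sum_congr rfl fun π _ => ?_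
  congr 1
  rw [eq_iff_iff]
  constructor
  · intro hπ
    ext x
    rw [mem_excSet, mem_range]
    constructor
    · rintro ⟨i, hi, rfl⟩
      exact (hπ i (by have := (π i).2; omega)).2 hi
    · intro hx
      exact ⟨⟨x, by omega⟩, (hπ ⟨x, by omega⟩ (by simp only; omega)).1 hx, rfl⟩
  · intro hX i _
    have : (i : ℕ) ∈ excSet π ↔ i < π i := by
      simp [mem_excSet, Fin.val_inj]
    rw [← this, hX, mem_range]
    rfl

theorem excWordCount_le_middle {n r : ℕ} (h : r < n) :
    excWordCount n r ≤ excWordCount n ((n - 1) / 2) := by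
  have key {q : ℕ} (hq : q < n) : excWordCount n q = stirlingPairing n q (n - 1 - q) := by
    rw [excWordCount_eq_excSum hq, ← excSum_eq_stirlingPairing _ hq]
    congr 1
    omega
  rw [key h, key (by omega)]
  exact stirlingPairing_le_middle n (n - 1) (by omega)

theorem not_hasStretchingPair_iff {n : ℕ} {c : Equiv.Perm (Fin (n + 2))} (hc : ∀ x, c x ≠ x) :
    ¬ HasStretchingPair c ↔ ∃ r ∈ range (n + 1), shiftDown (excSet c) = range r := by
  have hmem (i : Fin (n + 1)) : (i : ℕ) ∈ shiftDown (excSet c) ↔ i.succ < c i.succ := by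
    simp [shiftDown, mem_excSet, ← Fin.val_succ, Fin.val_inj]
  constructor
  · intro h
    have hdown (i j : Fin (n + 2)) (hij : i < j) (hj : j < c j) : i < c i := by
      by_contra hi
      exact h ⟨i, j, lt_of_le_of_ne (not_lt.1 hi) (hc i), hij, hj⟩
    have hlt {x : ℕ} (hx : x ∈ shiftDown (excSet c)) : x < n := by
      have := excSet_subset_range c (mem_preimage.1 hx)
      have hxn : x < n + 1 := by simpa using this
      have := (hmem ⟨x, hxn⟩).1 hx
      have h2 := (c (Fin.succ ⟨x, hxn⟩)).2
      rw [Fin.lt_def, Fin.val_succ] at this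
      simp only at this
      omega
    have hex : ∃ r, r ∉ shiftDown (excSet c) := ⟨n, fun hn => lt_irrefl _ (hlt hn)⟩
    have hr : Nat.find hex ≤ n := Nat.find_min' hex fun hn => lt_irrefl _ (hlt hn)
    refine ⟨Nat.find hex, mem_range.2 (Nat.lt_succ_of_le hr), ?_⟩
    ext x
    rw [mem_range]
    refine ⟨fun hx => ?_, fun hx => not_not.1 (Nat.find_min hex hx)⟩
    by_contra hge
    rcases (not_lt.1 hge).eq_or_lt with e | hlt'
    · exact Nat.find_spec hex (e ▸ hx)
    · have hxn := hlt hx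
      refine Nat.find_spec hex ((hmem ⟨Nat.find hex, by omega⟩).2 ?_)
      refine hdown _ (Fin.succ ⟨x, by omega⟩) ?_ ((hmem ⟨x, by omega⟩).1 hx)
      exact Fin.succ_lt_succ_iff.2 hlt'
  · rintro ⟨r, -, hr⟩ ⟨i, j, hi, hij, hj⟩
    obtain ⟨i, rfl⟩ := Fin.exists_succ_eq.2 (Fin.ne_zero_of_lt hi)
    obtain ⟨j, rfl⟩ := Fin.exists_succ_eq.2 (Fin.ne_zero_of_lt hij)
    rw [← hmem, hr, mem_range] at hj
    have hij' : (i : ℕ) < j := Fin.succ_lt_succ_iff.1 hij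
    exact hi.asymm ((hmem i).1 (hr ▸ mem_range.2 (hij'.trans hj)))

theorem cStarCard_eq_sum {n : ℕ} (hn : 0 < n) :
    cStarCard (n + 1) = ∑ r ∈ range n, excWordCount n r := by
  classical
  obtain ⟨n, rfl⟩ : ∃ n', n = n' + 1 := ⟨n - 1, by omega⟩
  rw [sum_congr rfl fun r hr => excWordCount_eq_excSum (mem_range.1 hr), ← excSum_sum,
    ← sum_isFullCycle_eq_excSum, cStarCard, Nat.card_eq_fintype_card, Fintype.card_subtype,
    card_filter]
  refine sum_congr rfl fun c _ => ?_
  simp only [← and_assoc, isCycle_and_card_support_iff]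
  by_cases hc : IsFullCycle c
  · simp only [hc, true_and, if_true, not_hasStretchingPair_iff hc.apply_ne]
    split_ifs with h
    · obtain ⟨r, hr, e⟩ := h
      rw [sum_eq_single_of_mem r hr, if_pos e]
      intro r' _ hne
      rw [if_neg]
      intro e'
      exact hne (by simpa using congrArg card (e'.symm.trans e))
    · refine (sum_eq_zero fun r hr => if_neg fun e => h ⟨r, hr, e⟩).symm
  · simp [hc]

theorem stmt16 (n : ℕ) (hn : 0 < n) :
    excWordCount n ((n - 1) / 2) ≤ cStarCard (n + 1) ∧
    cStarCard (n + 1) ≤ n * excWordCount n ((n - 1) / 2) := by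
  rw [cStarCard_eq_sum hn]
  constructor
  · exact single_le_sum (f := excWordCount n) (fun _ _ => Nat.zero_le _)
      (mem_range.2 (by omega))
  · simpa using sum_le_card_nsmul (range n) (excWordCount n) _
      fun r hr => excWordCount_le_middle (mem_range.1 hr)
end
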